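/- arXiv:2502.05501 — 2 statements merged into one kernel-verified Lean document; each statement's English description precedes it below -/
import Mathlib

section
/- Assume 1 − αR₁/μ ≥ 0. Then for every Navier-admissible pair V = (v_r, v_θ): (i) ‖v_r‖_{L∞(Ω̃)}² ≤ 2 ‖v_r‖_{L²(Ω̃)} ( ‖∂_{rr} v_r‖_{L²(Ω̃)}^{1/2} ‖∂_{θθ} v_r‖_{L²(Ω̃)}^{1/2} + ‖∂_{rθ} v_r‖_{L²(Ω̃)} ); and (ii) there exists C > 0 depending only on R₁, R₂ such that ‖v_θ‖_{L∞(Ω̃)}² ≤ C ‖v_θ‖_{L²(Ω̃)} ( ‖∂_{rr} v_θ‖_{L²(Ω̃)} + ‖∂_{θθ} v_θ‖_{L²(Ω̃)} + ‖∂_{rθ} v_θ‖_{L²(Ω̃)} ). Here ‖f‖_{L∞(Ω̃)} = sup_{(r,θ)∈Ω̃} |f(r,θ)|. -/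
open Real MeasureTheory Set

noncomputable section

/-- Partial derivative in the radial variable. -/
def pdr (f : ℝ → ℝ → ℝ) (r θ : ℝ) : ℝ := deriv (fun x => f x θ) r

/-- Partial derivative in the angular variable. -/
def pdt (f : ℝ → ℝ → ℝ) (r θ : ℝ) : ℝ := deriv (fun y => f r y) θ

/-- An admissible pair `V = (v_r, v_θ)`: smooth, `2π`-periodic in `θ`,
divergence free (`∂_r (r v_r) + ∂_θ v_θ = 0`), with `v_r` vanishing on both
boundary circles and `v_θ` vanishing on the outer one (the smooth version of
the space `G^{1,2}` of the paper). -/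
def Admissible (R₁ R₂ : ℝ) (vr vθ : ℝ → ℝ → ℝ) : Prop :=
  ContDiff ℝ (⊤ : ℕ∞) (fun p : ℝ × ℝ => vr p.1 p.2) ∧
  ContDiff ℝ (⊤ : ℕ∞) (fun p : ℝ × ℝ => vθ p.1 p.2) ∧
  (∀ r ∈ Icc R₁ R₂, ∀ θ : ℝ, vr r (θ + 2 * π) = vr r θ) ∧
  (∀ r ∈ Icc R₁ R₂, ∀ θ : ℝ, vθ r (θ + 2 * π) = vθ r θ) ∧
  (∀ r ∈ Icc R₁ R₂, ∀ θ : ℝ, deriv (fun x => x * vr x θ) r + pdt vθ r θ = 0) ∧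
  (∀ θ : ℝ, vr R₁ θ = 0) ∧ (∀ θ : ℝ, vr R₂ θ = 0) ∧ (∀ θ : ℝ, vθ R₂ θ = 0)

/-- The squared `L²(Ω̃)` norm of the gradient `∇̃V`. -/
def gradSq (R₁ R₂ : ℝ) (vr vθ : ℝ → ℝ → ℝ) : ℝ :=
  ∫ r in R₁..R₂, ∫ θ in (0:ℝ)..(2 * π),
    ((pdr vr r θ) ^ 2 + (pdt vr r θ) ^ 2 + (pdr vθ r θ) ^ 2 + (pdt vθ r θ) ^ 2)

/-- Second-order partial derivatives. -/
def pdrr (f : ℝ → ℝ → ℝ) : ℝ → ℝ → ℝ := pdr (pdr f)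
def pdtt (f : ℝ → ℝ → ℝ) : ℝ → ℝ → ℝ := pdt (pdt f)
def pdrt (f : ℝ → ℝ → ℝ) : ℝ → ℝ → ℝ := pdr (pdt f)

/-- A Navier-admissible pair: admissible, and in addition satisfying the Navier-slip
boundary condition `∂_r v_θ(R₁,θ) = (1/R₁ − α/μ) v_θ(R₁,θ)` (the smooth version of
the space `V^{1,2}` of the paper). -/
def NavierAdmissible (R₁ R₂ μ α : ℝ) (vr vθ : ℝ → ℝ → ℝ) : Prop :=
  Admissible R₁ R₂ vr vθ ∧ ∀ θ : ℝ, pdr vθ R₁ θ = (1 / R₁ - α / μ) * vθ R₁ θ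

/-- The `L²(Ω̃)` norm of a scalar function. -/
def nL2 (R₁ R₂ : ℝ) (f : ℝ → ℝ → ℝ) : ℝ :=
  Real.sqrt (∫ r in R₁..R₂, ∫ θ in (0:ℝ)..(2 * π), (f r θ) ^ 2)

/-- The sup norm over `Ω̃ = [R₁,R₂] × [0,2π]`. -/
def supNorm (R₁ R₂ : ℝ) (f : ℝ → ℝ → ℝ) : ℝ :=
  sSup ((fun p : ℝ × ℝ => |f p.1 p.2|) '' (Icc R₁ R₂ ×ˢ Icc (0:ℝ) (2 * π)))

/-- The iterated integral over `[a,b] × [0,2π]`. -/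
def dblInt (a b : ℝ) (f : ℝ → ℝ → ℝ) : ℝ :=
  ∫ r in a..b, ∫ θ in (0:ℝ)..(2 * π), f r θ

section Integrals

variable {a b : ℝ} {f g : ℝ → ℝ → ℝ}

lemma continuous_slice_left (hf : Continuous (Function.uncurry f)) (θ : ℝ) :
    Continuous fun r => f r θ :=
  hf.comp (by fun_prop : Continuous fun r : ℝ => (r, θ))

lemma continuous_slice_right (hf : Continuous (Function.uncurry f)) (r : ℝ) :
    Continuous (f r) :=
  hf.comp (by fun_prop : Continuous fun θ : ℝ => (r, θ))

lemma continuous_integral_right (hf : Continuous (Function.uncurry f)) (c d : ℝ) :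
    Continuous fun r => ∫ θ in c..d, f r θ :=
  intervalIntegral.continuous_parametric_intervalIntegral_of_continuous' hf c d

lemma continuous_integral_left (hf : Continuous (Function.uncurry f)) (c d : ℝ) :
    Continuous fun θ => ∫ r in c..d, f r θ :=
  continuous_integral_right (f := fun θ r => f r θ) (hf.comp continuous_swap) c d

lemma integral_swap_of_continuous (hf : Continuous (Function.uncurry f)) (a b c d : ℝ) :
    ∫ r in a..b, ∫ θ in c..d, f r θ = ∫ θ in c..d, ∫ r in a..b, f r θ :=
  intervalIntegral_intervalIntegral_swap <|
    (hf.continuousOn.integrableOn_compact (isCompact_uIcc.prod isCompact_uIcc)).mono_set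
      (prod_mono uIoc_subset_uIcc uIoc_subset_uIcc)

lemma dblInt_mono (hab : a ≤ b) (hf : Continuous (Function.uncurry f))
    (hg : Continuous (Function.uncurry g))
    (h : ∀ r ∈ Icc a b, ∀ θ ∈ Icc 0 (2 * π), f r θ ≤ g r θ) : dblInt a b f ≤ dblInt a b g :=
  intervalIntegral.integral_mono_on hab
    ((continuous_integral_right hf _ _).intervalIntegrable _ _)
    ((continuous_integral_right hg _ _).intervalIntegrable _ _) fun r hr =>
      intervalIntegral.integral_mono_on two_pi_pos.le
        ((continuous_slice_right hf r).intervalIntegrable _ _)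
        ((continuous_slice_right hg r).intervalIntegrable _ _) (h r hr)

lemma dblInt_add (hf : Continuous (Function.uncurry f)) (hg : Continuous (Function.uncurry g)) :
    dblInt a b (fun r θ => f r θ + g r θ) = dblInt a b f + dblInt a b g := by
  unfold dblInt
  rw [← intervalIntegral.integral_add
    ((continuous_integral_right hf _ _).intervalIntegrable _ _)
    ((continuous_integral_right hg _ _).intervalIntegrable _ _)]
  refine intervalIntegral.integral_congr fun r _ => ?_
  exact intervalIntegral.integral_add
    ((continuous_slice_right hf r).intervalIntegrable _ _)
    ((continuous_slice_right hg r).intervalIntegrable _ _)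

lemma dblInt_const_mul (c : ℝ) :
    dblInt a b (fun r θ => c * f r θ) = c * dblInt a b f := by
  simp [dblInt]

lemma dblInt_nonneg (hab : a ≤ b) (h : ∀ r θ, 0 ≤ f r θ) : 0 ≤ dblInt a b f :=
  intervalIntegral.integral_nonneg hab fun r _ =>
    intervalIntegral.integral_nonneg two_pi_pos.le fun θ _ => h r θ

lemma nL2_nonneg : 0 ≤ nL2 a b f := Real.sqrt_nonneg _

lemma nL2_sq (hab : a ≤ b) : nL2 a b f ^ 2 = dblInt a b (fun r θ => f r θ ^ 2) :=
  Real.sq_sqrt (dblInt_nonneg (f := fun r θ => f r θ ^ 2) hab fun _ _ => sq_nonneg _)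

/-- The Cauchy–Schwarz inequality on `[a,b] × [0,2π]`. -/
lemma dblInt_abs_mul_abs_le (hab : a ≤ b) (hf : Continuous (Function.uncurry f))
    (hg : Continuous (Function.uncurry g)) :
    dblInt a b (fun r θ => |f r θ| * |g r θ|) ≤ nL2 a b f * nL2 a b g := by
  have hff : Continuous (Function.uncurry fun r θ => f r θ ^ 2) := hf.pow 2
  have hgg : Continuous (Function.uncurry fun r θ => g r θ ^ 2) := hg.pow 2
  have hfg : Continuous (Function.uncurry fun r θ => |f r θ| * |g r θ|) := hf.abs.mul hg.abs
  have key : ∀ t : ℝ, 0 ≤ dblInt a b (fun r θ => g r θ ^ 2) * (t * t)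
      + (2 * dblInt a b (fun r θ => |f r θ| * |g r θ|)) * t
      + dblInt a b (fun r θ => f r θ ^ 2) := by
    intro t
    have h0 : 0 ≤ dblInt a b (fun r θ => (t * t) * g r θ ^ 2
        + ((2 * t) * (|f r θ| * |g r θ|) + f r θ ^ 2)) := by
      refine dblInt_nonneg hab fun r θ => ?_
      rw [← sq_abs (f r θ), ← sq_abs (g r θ)]
      nlinarith [sq_nonneg (t * |g r θ| + |f r θ|)]
    have hsum : Continuous (Function.uncurry fun r θ =>
        (2 * t) * (|f r θ| * |g r θ|) + f r θ ^ 2) := (hfg.const_mul (2 * t)).add hff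
    rw [dblInt_add (f := fun r θ => (t * t) * g r θ ^ 2)
        (g := fun r θ => (2 * t) * (|f r θ| * |g r θ|) + f r θ ^ 2)
        (hgg.const_mul (t * t)) hsum,
      dblInt_add (f := fun r θ => (2 * t) * (|f r θ| * |g r θ|)) (g := fun r θ => f r θ ^ 2)
        (hfg.const_mul (2 * t)) hff, dblInt_const_mul, dblInt_const_mul] at h0
    linarith
  have hd := discrim_le_zero key
  rw [discrim, ← nL2_sq hab, ← nL2_sq hab] at hd
  refine abs_le_of_sq_le_sq' ?_ (mul_nonneg nL2_nonneg nL2_nonneg) |>.2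
  nlinarith

/-- Oscillation bound: `|φ x - φ y|` is at most the integral of any majorant of `|φ'|`. -/
lemma abs_sub_le_integral_of_abs_deriv_le {φ φ' h : ℝ → ℝ} {x y : ℝ}
    (hφ : ∀ t, HasDerivAt φ (φ' t) t) (hφ' : Continuous φ') (hh : Continuous h)
    (hle : ∀ t, |φ' t| ≤ h t) (hx : x ∈ Icc a b) (hy : y ∈ Icc a b) :
    |φ x - φ y| ≤ ∫ t in a..b, h t := by
  wlog hyx : y ≤ x generalizing x y
  · rw [abs_sub_comm]
    exact this hy hx (le_of_not_ge hyx)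
  rw [← intervalIntegral.integral_eq_sub_of_hasDerivAt (fun t _ => hφ t)
    (hφ'.intervalIntegrable y x)]
  calc |∫ t in y..x, φ' t| ≤ ∫ t in y..x, |φ' t| :=
        intervalIntegral.abs_integral_le_integral_abs hyx
    _ ≤ ∫ t in y..x, h t := intervalIntegral.integral_mono_on hyx
        (hφ'.abs.intervalIntegrable _ _) (hh.intervalIntegrable _ _) fun t _ => hle t
    _ ≤ ∫ t in a..b, h t := intervalIntegral.integral_mono_interval hy.1 hyx hx.2
        (Filter.Eventually.of_forall fun t => (abs_nonneg _).trans (hle t))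
        (hh.intervalIntegrable _ _)

end Integrals

section PartialDerivatives

variable {f : ℝ → ℝ → ℝ}

lemma hasDerivAt_pdr (hf : ContDiff ℝ (⊤ : ℕ∞) (Function.uncurry f)) (r θ : ℝ) :
    HasDerivAt (fun x => f x θ) (pdr f r θ) r :=
  ((hf.differentiable (by simp)).comp (by fun_prop : Differentiable ℝ fun x : ℝ => (x, θ))
    r).hasDerivAt

lemma hasDerivAt_pdt (hf : ContDiff ℝ (⊤ : ℕ∞) (Function.uncurry f)) (r θ : ℝ) :
    HasDerivAt (f r) (pdt f r θ) θ :=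
  ((hf.differentiable (by simp)).comp (by fun_prop : Differentiable ℝ fun y : ℝ => (r, y))
    θ).hasDerivAt

lemma contDiff_pdr (hf : ContDiff ℝ (⊤ : ℕ∞) (Function.uncurry f)) :
    ContDiff ℝ (⊤ : ℕ∞) (Function.uncurry (pdr f)) := by
  have h : Function.uncurry (pdr f) = fun p => fderiv ℝ (Function.uncurry f) p (1, 0) := by
    ext ⟨r, θ⟩
    have h1 := (hf.differentiable (by simp) (r, θ)).hasFDerivAt.comp_hasDerivAt r
      ((hasDerivAt_id r).prodMk (hasDerivAt_const r θ))
    exact h1.deriv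
  rw [h]
  exact (hf.fderiv_right (by simp)).clm_apply contDiff_const

lemma contDiff_pdt (hf : ContDiff ℝ (⊤ : ℕ∞) (Function.uncurry f)) :
    ContDiff ℝ (⊤ : ℕ∞) (Function.uncurry (pdt f)) := by
  have h : Function.uncurry (pdt f) = fun p => fderiv ℝ (Function.uncurry f) p (0, 1) := by
    ext ⟨r, θ⟩
    have h1 := (hf.differentiable (by simp) (r, θ)).hasFDerivAt.comp_hasDerivAt θ
      ((hasDerivAt_const θ r).prodMk (hasDerivAt_id θ))
    exact h1.deriv
  rw [h]
  exact (hf.fderiv_right (by simp)).clm_apply contDiff_const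

end PartialDerivatives

section Estimates

variable {a b : ℝ} {f : ℝ → ℝ → ℝ}

/-- Interpolation in the angular variable, by integration by parts. -/
lemma nL2_pdt_sq_le (hab : a ≤ b) (hf : ContDiff ℝ (⊤ : ℕ∞) (Function.uncurry f))
    (hper : ∀ r ∈ Icc a b, ∀ θ, f r (θ + 2 * π) = f r θ) :
    nL2 a b (pdt f) ^ 2 ≤ nL2 a b f * nL2 a b (pdtt f) := by
  have hf1 := contDiff_pdt hf
  have hf2 := contDiff_pdt hf1
  have hper' : ∀ r ∈ Icc a b, pdt f r (2 * π) = pdt f r 0 := by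
    intro r hr
    have h : (fun θ => f r (θ + 2 * π)) = f r := funext (hper r hr)
    have h2 := deriv_comp_add_const (f := f r) (2 * π) 0
    rw [h, zero_add] at h2
    exact h2.symm
  rw [nL2_sq hab]
  refine le_trans ?_ (dblInt_abs_mul_abs_le hab hf.continuous hf2.continuous)
  have hL : Continuous (Function.uncurry fun r θ => pdt f r θ ^ 2) := hf1.continuous.pow 2
  refine intervalIntegral.integral_mono_on hab
    ((continuous_integral_right hL _ _).intervalIntegrable _ _)
    ((continuous_integral_right (f := fun r θ => |f r θ| * |pdt (pdt f) r θ|)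
      (hf.continuous.abs.mul hf2.continuous.abs) _ _).intervalIntegrable _ _) fun r hr => ?_
  have hc1 := continuous_slice_right hf1.continuous r
  have hc2 := continuous_slice_right hf2.continuous r
  have hc := continuous_slice_right hf.continuous r
  have hp0 : f r (2 * π) = f r 0 := by simpa using hper r hr 0
  have hparts := intervalIntegral.integral_mul_deriv_eq_deriv_mul (a := 0) (b := 2 * π)
    (fun θ _ => hasDerivAt_pdt hf r θ) (fun θ _ => hasDerivAt_pdt hf1 r θ)
    (hc1.intervalIntegrable _ _) (hc2.intervalIntegrable _ _)
  rw [hper' r hr, hp0, sub_self, zero_sub] at hparts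
  simp only [sq]
  rw [← neg_eq_iff_eq_neg.mpr hparts, ← intervalIntegral.integral_neg]
  refine intervalIntegral.integral_mono_on two_pi_pos.le
    ((hc.mul hc2).neg.intervalIntegrable _ _)
    ((hc.abs.mul hc2.abs).intervalIntegrable _ _) fun θ _ => ?_
  rw [← abs_mul]
  exact neg_le_abs _

/-- Interpolation in the radial variable, by integration by parts; the boundary terms have a
favourable sign. -/
lemma nL2_pdr_sq_le (hab : a ≤ b) (hf : ContDiff ℝ (⊤ : ℕ∞) (Function.uncurry f))
    (ha : ∀ θ, 0 ≤ f a θ * pdr f a θ) (hb : ∀ θ, f b θ = 0) :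
    nL2 a b (pdr f) ^ 2 ≤ nL2 a b f * nL2 a b (pdrr f) := by
  have hf1 := contDiff_pdr hf
  have hf2 := contDiff_pdr hf1
  rw [nL2_sq hab]
  refine le_trans ?_ (dblInt_abs_mul_abs_le hab hf.continuous hf2.continuous)
  have hL : Continuous (Function.uncurry fun r θ => pdr f r θ ^ 2) := hf1.continuous.pow 2
  have hR : Continuous (Function.uncurry fun r θ => |f r θ| * |pdr (pdr f) r θ|) :=
    hf.continuous.abs.mul hf2.continuous.abs
  unfold dblInt pdrr
  rw [integral_swap_of_continuous hL, integral_swap_of_continuous hR]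
  refine intervalIntegral.integral_mono_on two_pi_pos.le
    ((continuous_integral_left hL _ _).intervalIntegrable _ _)
    ((continuous_integral_left hR _ _).intervalIntegrable _ _) fun θ _ => ?_
  have hc1 := continuous_slice_left hf1.continuous θ
  have hc2 := continuous_slice_left hf2.continuous θ
  have hc := continuous_slice_left hf.continuous θ
  have hparts := intervalIntegral.integral_mul_deriv_eq_deriv_mul (a := a) (b := b)
    (fun r _ => hasDerivAt_pdr hf r θ) (fun r _ => hasDerivAt_pdr hf1 r θ)
    (hc1.intervalIntegrable _ _) (hc2.intervalIntegrable _ _)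
  have hmono : -∫ r in a..b, f r θ * pdr (pdr f) r θ
      ≤ ∫ r in a..b, |f r θ| * |pdr (pdr f) r θ| := by
    rw [← intervalIntegral.integral_neg]
    refine intervalIntegral.integral_mono_on hab
      ((hc.mul hc2).neg.intervalIntegrable _ _)
      ((hc.abs.mul hc2.abs).intervalIntegrable _ _) fun r _ => ?_
    rw [← abs_mul]
    exact neg_le_abs _
  rw [hb θ, zero_mul] at hparts
  simp only [sq]
  linarith [ha θ]

/-- A function vanishing at `r = b` satisfies `f² ≤ 2 ∫ |f| |∂_r f| dr`. -/
lemma sq_le_integral_abs_mul_pdr (hf : ContDiff ℝ (⊤ : ℕ∞) (Function.uncurry f))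
    (hb : ∀ θ, f b θ = 0) {r : ℝ} (hr : r ∈ Icc a b) (θ : ℝ) :
    f r θ ^ 2 ≤ ∫ s in a..b, 2 * (|f s θ| * |pdr f s θ|) := by
  have hc1 := continuous_slice_left (contDiff_pdr hf).continuous θ
  have hc := continuous_slice_left hf.continuous θ
  have h := abs_sub_le_integral_of_abs_deriv_le (φ := fun s => f s θ ^ 2)
    (φ' := fun s => 2 * (f s θ * pdr f s θ)) (h := fun s => 2 * (|f s θ| * |pdr f s θ|))
    (fun s => ((hasDerivAt_pdr hf s θ).pow 2).congr_deriv (by simp; ring))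
    (by fun_prop) (by fun_prop) (fun s => by simp [abs_mul]) hr
    (right_mem_Icc.2 (hr.1.trans hr.2))
  simp only [hb θ] at h
  exact (le_abs_self _).trans (by simpa using h)

lemma integral_sq_le (hf : ContDiff ℝ (⊤ : ℕ∞) (Function.uncurry f))
    (hb : ∀ θ, f b θ = 0) {r : ℝ} (hr : r ∈ Icc a b) :
    ∫ θ in (0:ℝ)..(2 * π), f r θ ^ 2 ≤ 2 * (nL2 a b f * nL2 a b (pdr f)) := by
  have hab : a ≤ b := hr.1.trans hr.2
  have hf1 := contDiff_pdr hf
  have hR : Continuous (Function.uncurry fun r θ => 2 * (|f r θ| * |pdr f r θ|)) :=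
    (hf.continuous.abs.mul hf1.continuous.abs).const_mul 2
  calc ∫ θ in (0:ℝ)..(2 * π), f r θ ^ 2
      ≤ ∫ θ in (0:ℝ)..(2 * π), ∫ s in a..b, 2 * (|f s θ| * |pdr f s θ|) :=
        intervalIntegral.integral_mono_on two_pi_pos.le
          (((continuous_slice_right hf.continuous r).pow 2).intervalIntegrable _ _)
          ((continuous_integral_left hR _ _).intervalIntegrable _ _)
          fun θ _ => sq_le_integral_abs_mul_pdr hf hb hr θ
    _ = dblInt a b fun r θ => 2 * (|f r θ| * |pdr f r θ|) :=
        (integral_swap_of_continuous hR _ _ _ _).symm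
    _ ≤ 2 * (nL2 a b f * nL2 a b (pdr f)) := by
        rw [dblInt_const_mul (f := fun r θ => |f r θ| * |pdr f r θ|)]
        have := dblInt_abs_mul_abs_le hab hf.continuous hf1.continuous
        linarith

/-- A Poincaré inequality for functions vanishing at `r = b`. -/
lemma nL2_le_nL2_pdr (hab : a ≤ b) (hf : ContDiff ℝ (⊤ : ℕ∞) (Function.uncurry f))
    (hb : ∀ θ, f b θ = 0) : nL2 a b f ≤ 2 * (b - a) * nL2 a b (pdr f) := by
  have h : nL2 a b f ^ 2 ≤ (b - a) * (2 * (nL2 a b f * nL2 a b (pdr f))) := by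
    have hL : Continuous (Function.uncurry fun r θ => f r θ ^ 2) := hf.continuous.pow 2
    rw [nL2_sq hab, ← smul_eq_mul, ← intervalIntegral.integral_const]
    exact intervalIntegral.integral_mono_on hab
      ((continuous_integral_right hL _ _).intervalIntegrable _ _)
      (by simp) fun r hr => integral_sq_le hf hb hr
  have hn : 0 ≤ nL2 a b (pdr f) := nL2_nonneg
  rcases (nL2_nonneg : 0 ≤ nL2 a b f).eq_or_lt with h0 | h0
  · rw [← h0]
    exact mul_nonneg (mul_nonneg zero_le_two (sub_nonneg.2 hab)) hn
  · refine le_of_mul_le_mul_left ?_ h0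
    linarith

/-- Oscillation of `f²` on circles, in terms of first derivatives and the mixed derivative. -/
lemma sq_le_sq_add_of_pdt (hf : ContDiff ℝ (⊤ : ℕ∞) (Function.uncurry f))
    (hb : ∀ θ, f b θ = 0) {r θ θ' : ℝ} (hr : r ∈ Icc a b) (hθ : θ ∈ Icc 0 (2 * π))
    (hθ' : θ' ∈ Icc 0 (2 * π)) :
    f r θ ^ 2 ≤ f r θ' ^ 2 + 2 * (nL2 a b (pdr f) * nL2 a b (pdt f)
      + nL2 a b f * nL2 a b (pdrt f)) := by
  have hab : a ≤ b := hr.1.trans hr.2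
  have hr1 := contDiff_pdr hf
  have ht1 := contDiff_pdt hf
  have hrt := contDiff_pdr ht1
  have hA : Continuous (Function.uncurry fun r θ => |pdr f r θ| * |pdt f r θ|) :=
    hr1.continuous.abs.mul ht1.continuous.abs
  have hB : Continuous (Function.uncurry fun r θ => |f r θ| * |pdr (pdt f) r θ|) :=
    hf.continuous.abs.mul hrt.continuous.abs
  have hK : Continuous (Function.uncurry fun r θ => |pdr f r θ| * |pdt f r θ|
      + |f r θ| * |pdr (pdt f) r θ|) := hA.add hB
  have hbound : ∀ θ, |f r θ * pdt f r θ| ≤ ∫ s in a..b, (|pdr f s θ| * |pdt f s θ|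
      + |f s θ| * |pdr (pdt f) s θ|) := by
    intro θ
    have h0 := continuous_slice_left hf.continuous θ
    have h1 := continuous_slice_left hr1.continuous θ
    have h2 := continuous_slice_left ht1.continuous θ
    have h3 := continuous_slice_left hrt.continuous θ
    have h := abs_sub_le_integral_of_abs_deriv_le (φ := fun s => f s θ * pdt f s θ)
      (h := fun s => |pdr f s θ| * |pdt f s θ| + |f s θ| * |pdr (pdt f) s θ|)
      (fun s => (hasDerivAt_pdr hf s θ).mul (hasDerivAt_pdr ht1 s θ))
      (by fun_prop) (by fun_prop)
      (fun s => (abs_add_le _ _).trans (by rw [abs_mul, abs_mul])) hr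
      (right_mem_Icc.2 hab)
    simpa [hb θ] using h
  have hc := continuous_slice_right hf.continuous r
  have hc1 := continuous_slice_right ht1.continuous r
  have hosc := abs_sub_le_integral_of_abs_deriv_le (φ := fun t => f r t ^ 2)
    (φ' := fun t => 2 * (f r t * pdt f r t)) (h := fun t => 2 * |f r t * pdt f r t|)
    (fun t => ((hasDerivAt_pdt hf r t).pow 2).congr_deriv (by simp; ring))
    (by fun_prop) (by fun_prop) (fun t => by simp [abs_mul]) hθ hθ'
  have hint : ∫ t in (0:ℝ)..(2 * π), |f r t * pdt f r t|
      ≤ nL2 a b (pdr f) * nL2 a b (pdt f) + nL2 a b f * nL2 a b (pdrt f) := by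
    calc ∫ t in (0:ℝ)..(2 * π), |f r t * pdt f r t|
        ≤ ∫ t in (0:ℝ)..(2 * π), ∫ s in a..b, (|pdr f s t| * |pdt f s t|
            + |f s t| * |pdr (pdt f) s t|) :=
          intervalIntegral.integral_mono_on two_pi_pos.le
            ((hc.mul hc1).abs.intervalIntegrable _ _)
            ((continuous_integral_left hK _ _).intervalIntegrable _ _) fun t _ => hbound t
      _ = dblInt a b fun s t => |pdr f s t| * |pdt f s t| + |f s t| * |pdr (pdt f) s t| :=
          (integral_swap_of_continuous hK _ _ _ _).symm
      _ ≤ _ := by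
          rw [dblInt_add hA hB]
          exact add_le_add (dblInt_abs_mul_abs_le hab hr1.continuous ht1.continuous)
            (dblInt_abs_mul_abs_le hab hf.continuous hrt.continuous)
  rw [intervalIntegral.integral_const_mul] at hosc
  have := (le_abs_self _).trans hosc
  linarith

/-- The product of the first-order norms, estimated by the second-order ones. -/
lemma nL2_pdr_mul_nL2_pdt_le (hab : a ≤ b) (hf : ContDiff ℝ (⊤ : ℕ∞) (Function.uncurry f))
    (hper : ∀ r ∈ Icc a b, ∀ θ, f r (θ + 2 * π) = f r θ)
    (ha : ∀ θ, 0 ≤ f a θ * pdr f a θ) (hb : ∀ θ, f b θ = 0) :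
    nL2 a b (pdr f) * nL2 a b (pdt f)
      ≤ nL2 a b f * (√(nL2 a b (pdrr f)) * √(nL2 a b (pdtt f))) := by
  have h0 : 0 ≤ nL2 a b f := nL2_nonneg
  refine abs_le_of_sq_le_sq' ?_ (by positivity) |>.2
  calc (nL2 a b (pdr f) * nL2 a b (pdt f)) ^ 2
      = nL2 a b (pdr f) ^ 2 * nL2 a b (pdt f) ^ 2 := by ring
    _ ≤ (nL2 a b f * nL2 a b (pdrr f)) * (nL2 a b f * nL2 a b (pdtt f)) :=
        mul_le_mul (nL2_pdr_sq_le hab hf ha hb) (nL2_pdt_sq_le hab hf hper) (sq_nonneg _)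
          (mul_nonneg h0 nL2_nonneg)
    _ = (nL2 a b f * (√(nL2 a b (pdrr f)) * √(nL2 a b (pdtt f)))) ^ 2 := by
        rw [mul_pow, mul_pow, Real.sq_sqrt nL2_nonneg, Real.sq_sqrt nL2_nonneg]
        ring

lemma supNorm_sq_le (hab : a ≤ b) {B : ℝ}
    (h : ∀ r ∈ Icc a b, ∀ θ ∈ Icc 0 (2 * π), f r θ ^ 2 ≤ B) : supNorm a b f ^ 2 ≤ B := by
  have hB : 0 ≤ B :=
    (sq_nonneg _).trans (h a (left_mem_Icc.2 hab) 0 (left_mem_Icc.2 two_pi_pos.le))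
  have h1 : supNorm a b f ≤ √B := by
    refine csSup_le (Nonempty.image _ ⟨(a, 0), left_mem_Icc.2 hab,
      left_mem_Icc.2 two_pi_pos.le⟩) ?_
    rintro _ ⟨⟨r, θ⟩, ⟨hr, hθ⟩, rfl⟩
    exact Real.abs_le_sqrt (h r hr θ hθ)
  have h2 : 0 ≤ supNorm a b f := by
    refine Real.sSup_nonneg ?_
    rintro _ ⟨p, _, rfl⟩
    exact abs_nonneg _
  exact (Real.le_sqrt h2 hB).1 h1

lemma exists_eq_zero_of_integral_eq_zero {φ : ℝ → ℝ} (hab : a < b) (hφ : Continuous φ)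
    (h : ∫ t in a..b, φ t = 0) : ∃ t ∈ Icc a b, φ t = 0 := by
  have hd : ∀ x, HasDerivAt (fun x => ∫ t in a..x, φ t) (φ x) x := fun x =>
    intervalIntegral.integral_hasDerivAt_right (hφ.intervalIntegrable _ _)
      (hφ.stronglyMeasurableAtFilter _ _) hφ.continuousAt
  obtain ⟨c, hc, hc0⟩ := exists_hasDerivAt_eq_zero hab
    (fun x _ => (hd x).continuousAt.continuousWithinAt) (by simp [h]) fun x _ => hd x
  exact ⟨c, Ioo_subset_Icc_self hc, hc0⟩

/-- The radial component of an admissible pair has zero mean on every circle. -/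
lemma Admissible.integral_radial_eq_zero {vr vθ : ℝ → ℝ → ℝ} (h : Admissible a b vr vθ)
    (ha : 0 < a) {r : ℝ} (hr : r ∈ Icc a b) : ∫ θ in (0:ℝ)..(2 * π), vr r θ = 0 := by
  obtain ⟨hvr, hvθ, -, hper, hdiv, h0, -, -⟩ := h
  have hθ1 := contDiff_pdt (f := vθ) hvθ
  have hsub : uIcc a r ⊆ Icc a b := by
    rw [uIcc_of_le hr.1]
    exact Icc_subset_Icc_right hr.2
  have hflux : ∀ θ, r * vr r θ = -∫ s in a..r, pdt vθ s θ := by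
    intro θ
    have hd : ∀ s ∈ uIcc a r, HasDerivAt (fun x => x * vr x θ) (-pdt vθ s θ) s := by
      intro s hs
      rw [← eq_neg_of_add_eq_zero_left (hdiv s (hsub hs) θ)]
      exact (differentiableAt_id.mul
        (hasDerivAt_pdr (f := vr) hvr s θ).differentiableAt).hasDerivAt
    have := intervalIntegral.integral_eq_sub_of_hasDerivAt hd
      ((continuous_slice_left hθ1.continuous θ).neg.intervalIntegrable _ _)
    rw [h0, mul_zero, sub_zero, intervalIntegral.integral_neg] at this
    exact this.symm
  have hzero : ∀ s ∈ uIcc a r, ∫ θ in (0:ℝ)..(2 * π), pdt vθ s θ = 0 := by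
    intro s hs
    rw [intervalIntegral.integral_eq_sub_of_hasDerivAt
      (fun θ _ => hasDerivAt_pdt (f := vθ) hvθ s θ)
      ((continuous_slice_right hθ1.continuous s).intervalIntegrable _ _), sub_eq_zero]
    simpa using hper s (hsub hs) 0
  have hr0 : r ≠ 0 := (ha.trans_le hr.1).ne'
  have : r * ∫ θ in (0:ℝ)..(2 * π), vr r θ = 0 := by
    rw [← intervalIntegral.integral_const_mul]
    simp only [hflux]
    rw [intervalIntegral.integral_neg, ← integral_swap_of_continuous hθ1.continuous,
      intervalIntegral.integral_congr hzero]
    simp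
  exact (mul_eq_zero.1 this).resolve_left hr0

end Estimates

theorem statement4 (R₁ R₂ : ℝ) (hR₁ : 0 < R₁) (hR₁₂ : R₁ < R₂) :
    (∀ μ α : ℝ, 0 < μ → 0 ≤ 1 - α * R₁ / μ →
      ∀ vr vθ : ℝ → ℝ → ℝ, NavierAdmissible R₁ R₂ μ α vr vθ →
        supNorm R₁ R₂ vr ^ 2 ≤
          2 * nL2 R₁ R₂ vr *
            (Real.sqrt (nL2 R₁ R₂ (pdrr vr)) * Real.sqrt (nL2 R₁ R₂ (pdtt vr)) +
              nL2 R₁ R₂ (pdrt vr))) ∧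
    (∃ C : ℝ, 0 < C ∧
      ∀ μ α : ℝ, 0 < μ → 0 ≤ 1 - α * R₁ / μ →
        ∀ vr vθ : ℝ → ℝ → ℝ, NavierAdmissible R₁ R₂ μ α vr vθ →
          supNorm R₁ R₂ vθ ^ 2 ≤
            C * nL2 R₁ R₂ vθ *
              (nL2 R₁ R₂ (pdrr vθ) + nL2 R₁ R₂ (pdtt vθ) + nL2 R₁ R₂ (pdrt vθ))) := by
  refine ⟨?_, 2 * (R₂ - R₁) + 2, by linarith, ?_⟩
  · rintro μ α - - vr vθ ⟨hadm, -⟩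
    have hmean := fun r hr => hadm.integral_radial_eq_zero hR₁ (r := r) hr
    obtain ⟨hvr, -, hper, -, -, ha, hb, -⟩ := hadm
    refine supNorm_sq_le hR₁₂.le fun r hr θ hθ => ?_
    obtain ⟨θ', hθ', h0⟩ := exists_eq_zero_of_integral_eq_zero two_pi_pos
      (continuous_slice_right (f := vr) hvr.continuous r) (hmean r hr)
    have h1 := sq_le_sq_add_of_pdt (f := vr) hvr hb hr hθ hθ'
    have h2 := nL2_pdr_mul_nL2_pdt_le (f := vr) hR₁₂.le hvr hper (by simp [ha]) hb
    rw [h0] at h1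
    linarith
  · rintro μ α - hα vr vθ ⟨⟨-, hvθ, -, hper, -, -, -, hb⟩, hnav⟩
    have hk : 0 ≤ 1 / R₁ - α / μ := by
      have h : 1 / R₁ - α / μ = (1 - α * R₁ / μ) / R₁ := by
        field_simp
      rw [h]
      exact div_nonneg hα hR₁.le
    have ha : ∀ θ, 0 ≤ vθ R₁ θ * pdr vθ R₁ θ := fun θ => by
      rw [hnav θ, mul_left_comm]
      exact mul_nonneg hk (mul_self_nonneg _)
    refine supNorm_sq_le hR₁₂.le fun r hr θ hθ => ?_
    have hprod := nL2_pdr_mul_nL2_pdt_le (f := vθ) hR₁₂.le hvθ hper ha hb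
    have hpoin := nL2_le_nL2_pdr (f := vθ) hR₁₂.le hvθ hb
    have hrad := nL2_pdr_sq_le (f := vθ) hR₁₂.le hvθ ha hb
    have hmean := integral_sq_le (f := vθ) hvθ hb hr
    have hosc := fun θ' hθ' => sq_le_sq_add_of_pdt (f := vθ) (θ' := θ') hvθ hb hr hθ hθ'
    have hc := continuous_slice_right (f := vθ) hvθ.continuous r
    have hN : 0 ≤ nL2 R₁ R₂ vθ := nL2_nonneg
    have hNr : 0 ≤ nL2 R₁ R₂ (pdr vθ) := nL2_nonneg
    have hNrr : 0 ≤ nL2 R₁ R₂ (pdrr vθ) := nL2_nonneg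
    have hNtt : 0 ≤ nL2 R₁ R₂ (pdtt vθ) := nL2_nonneg
    have hNrt : 0 ≤ nL2 R₁ R₂ (pdrt vθ) := nL2_nonneg
    set K := 2 * (nL2 R₁ R₂ (pdr vθ) * nL2 R₁ R₂ (pdt vθ)
      + nL2 R₁ R₂ vθ * nL2 R₁ R₂ (pdrt vθ)) with hK
    have havg : (2 * π) * vθ r θ ^ 2 ≤ (∫ θ' in (0:ℝ)..(2 * π), vθ r θ' ^ 2) + (2 * π) * K := by
      have hc2 : Continuous fun θ' => vθ r θ' ^ 2 := hc.pow 2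
      have hcK : Continuous fun θ' => vθ r θ' ^ 2 + K := hc2.add continuous_const
      have h : ∫ _ in (0:ℝ)..(2 * π), vθ r θ ^ 2 ≤ ∫ θ' in (0:ℝ)..(2 * π), (vθ r θ' ^ 2 + K) :=
        intervalIntegral.integral_mono_on two_pi_pos.le intervalIntegrable_const
          (hcK.intervalIntegrable _ _) hosc
      rw [intervalIntegral.integral_add (hc2.intervalIntegrable _ _) intervalIntegrable_const] at h
      simpa using h
    have hr2 : nL2 R₁ R₂ (pdr vθ) ≤ 2 * (R₂ - R₁) * nL2 R₁ R₂ (pdrr vθ) := by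
      rcases hNr.eq_or_lt with h0 | h0
      · rw [← h0]
        exact mul_nonneg (mul_nonneg zero_le_two (sub_nonneg.2 hR₁₂.le)) hNrr
      · refine le_of_mul_le_mul_left ?_ h0
        have := mul_le_mul_of_nonneg_right hpoin hNrr
        linarith
    have hsup : vθ r θ ^ 2 ≤ nL2 R₁ R₂ vθ * nL2 R₁ R₂ (pdr vθ) + K := by
      have hP : 0 ≤ nL2 R₁ R₂ vθ * nL2 R₁ R₂ (pdr vθ) := mul_nonneg hN hNr
      refine le_of_mul_le_mul_left ?_ two_pi_pos
      nlinarith [mul_le_mul_of_nonneg_right pi_gt_three.le hP]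
    have hamgm : 2 * (√(nL2 R₁ R₂ (pdrr vθ)) * √(nL2 R₁ R₂ (pdtt vθ)))
        ≤ nL2 R₁ R₂ (pdrr vθ) + nL2 R₁ R₂ (pdtt vθ) := by
      have := two_mul_le_add_sq (√(nL2 R₁ R₂ (pdrr vθ))) (√(nL2 R₁ R₂ (pdtt vθ)))
      rw [Real.sq_sqrt hNrr, Real.sq_sqrt hNtt] at this
      linarith
    have h1 := mul_le_mul_of_nonneg_left hamgm hN
    have h2 := mul_le_mul_of_nonneg_left hr2 hN
    have hL : 0 ≤ R₂ - R₁ := sub_nonneg.2 hR₁₂.le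
    have p1 := mul_nonneg hN hNrr
    have p2 := mul_nonneg hN hNtt
    have p3 := mul_nonneg hL (mul_nonneg hN hNtt)
    have p4 := mul_nonneg hL (mul_nonneg hN hNrt)
    linarith

end
end

section
/- Assume 1 − αR₁/μ ≥ 0. Write Δ_r f = ∂_{rr} f + (1/r)∂_r f + (1/r²)∂_{θθ} f, and for a pair V = (v_r, v_θ) set S(V) = (Δ_r v_r − v_r/r² − (2/r²)∂_θ v_θ, Δ_r v_θ − v_θ/r² + (2/r²)∂_θ v_r) and Δ̃V = (∂_{rr} v_r + ∂_{θθ} v_r, ∂_{rr} v_θ + ∂_{θθ} v_θ). Then there exist constants C₁, C₂ > 0 depending only on R₁, R₂ such that for every Navier-admissible pair V one has C₁ ‖Δ̃V‖_{L²(Ω̃)}² ≤ ‖S(V)‖_{L²(Ω̃)}² ≤ C₂ ‖Δ̃V‖_{L²(Ω̃)}². -/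
open Real MeasureTheory Set

noncomputable section

/-- The polar Laplacian `Δ_r f = ∂_rr f + (1/r) ∂_r f + (1/r²) ∂_θθ f`. -/
def deltaR (f : ℝ → ℝ → ℝ) (r θ : ℝ) : ℝ :=
  pdrr f r θ + (1 / r) * pdr f r θ + (1 / r ^ 2) * pdtt f r θ

/-- The squared `L²` norm of `S(V)`. -/
def SSq (R₁ R₂ : ℝ) (vr vθ : ℝ → ℝ → ℝ) : ℝ :=
  ∫ r in R₁..R₂, ∫ θ in (0:ℝ)..(2 * π),
    ((deltaR vr r θ - vr r θ / r ^ 2 - (2 / r ^ 2) * pdt vθ r θ) ^ 2 +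
      (deltaR vθ r θ - vθ r θ / r ^ 2 + (2 / r ^ 2) * pdt vr r θ) ^ 2)

/-- The squared `L²` norm of `Δ̃V`. -/
def lapSq (R₁ R₂ : ℝ) (vr vθ : ℝ → ℝ → ℝ) : ℝ :=
  ∫ r in R₁..R₂, ∫ θ in (0:ℝ)..(2 * π),
    ((pdrr vr r θ + pdtt vr r θ) ^ 2 + (pdrr vθ r θ + pdtt vθ r θ) ^ 2)

/-- Joint smoothness of a function of two real variables, in curried form. -/
def Smooth (f : ℝ → ℝ → ℝ) : Prop := ContDiff ℝ (⊤ : ℕ∞) (fun p : ℝ × ℝ => f p.1 p.2)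

namespace Smooth

variable {f : ℝ → ℝ → ℝ}

theorem differentiable (hf : Smooth f) : Differentiable ℝ (fun p : ℝ × ℝ => f p.1 p.2) :=
  ContDiff.differentiable hf (by simp)

theorem hasDerivAt_pdr (hf : Smooth f) (r θ : ℝ) :
    HasDerivAt (fun x => f x θ) (pdr f r θ) r := by
  have h : Differentiable ℝ (fun x => f x θ) :=
    hf.differentiable.comp (differentiable_id.prodMk (differentiable_const θ))
  exact (h r).hasDerivAt

theorem hasDerivAt_pdt (hf : Smooth f) (r θ : ℝ) :
    HasDerivAt (fun y => f r y) (pdt f r θ) θ := by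
  have h : Differentiable ℝ (fun y => f r y) :=
    hf.differentiable.comp ((differentiable_const r).prodMk differentiable_id)
  exact (h θ).hasDerivAt

theorem pdr_eq_fderiv (hf : Smooth f) (r θ : ℝ) :
    pdr f r θ = fderiv ℝ (fun p : ℝ × ℝ => f p.1 p.2) (r, θ) (1, 0) := by
  have h := (hf.differentiable (r, θ)).hasFDerivAt.comp_hasDerivAt r
    ((hasDerivAt_id r).prodMk (hasDerivAt_const r θ))
  exact h.deriv

theorem pdt_eq_fderiv (hf : Smooth f) (r θ : ℝ) :
    pdt f r θ = fderiv ℝ (fun p : ℝ × ℝ => f p.1 p.2) (r, θ) (0, 1) := by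
  have h := (hf.differentiable (r, θ)).hasFDerivAt.comp_hasDerivAt θ
    ((hasDerivAt_const θ r).prodMk (hasDerivAt_id θ))
  exact h.deriv

theorem pdr (hf : Smooth f) : Smooth (pdr f) := by
  have h : ContDiff ℝ (⊤ : ℕ∞)
      (fun p : ℝ × ℝ => fderiv ℝ (fun p : ℝ × ℝ => f p.1 p.2) p (1, 0)) :=
    (ContDiff.fderiv_right hf (by simp)).clm_apply contDiff_const
  unfold Smooth
  simpa only [hf.pdr_eq_fderiv] using h

theorem pdt (hf : Smooth f) : Smooth (pdt f) := by
  have h : ContDiff ℝ (⊤ : ℕ∞)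
      (fun p : ℝ × ℝ => fderiv ℝ (fun p : ℝ × ℝ => f p.1 p.2) p (0, 1)) :=
    (ContDiff.fderiv_right hf (by simp)).clm_apply contDiff_const
  unfold Smooth
  simpa only [hf.pdt_eq_fderiv] using h

theorem pdr_pdt (hf : Smooth f) (r θ : ℝ) :
    _root_.pdr (_root_.pdt f) r θ = _root_.pdt (_root_.pdr f) r θ := by
  have hd : Differentiable ℝ (fderiv ℝ (fun p : ℝ × ℝ => f p.1 p.2)) :=
    (ContDiff.fderiv_right (m := 1) hf (by norm_cast)).differentiable (by simp)
  have hs : IsSymmSndFDerivAt ℝ (fun p : ℝ × ℝ => f p.1 p.2) (r, θ) :=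
    (ContDiff.contDiffAt hf).isSymmSndFDerivAt (by
      rw [minSmoothness_of_isRCLikeNormedField]
      exact WithTop.coe_le_coe.2 (le_top : (2 : ℕ∞) ≤ ⊤))
  rw [hf.pdt.pdr_eq_fderiv, hf.pdr.pdt_eq_fderiv]
  simp only [hf.pdt_eq_fderiv, hf.pdr_eq_fderiv]
  rw [fderiv_clm_apply (hd _) (differentiableAt_const _),
    fderiv_clm_apply (hd _) (differentiableAt_const _)]
  simpa using hs (1, 0) (0, 1)

end Smooth

/-- `2π`-periodicity in the angular variable over the radial band. -/
def AngularPeriodic (R₁ R₂ : ℝ) (f : ℝ → ℝ → ℝ) : Prop :=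
  ∀ r ∈ Icc R₁ R₂, ∀ θ : ℝ, f r (θ + 2 * π) = f r θ

theorem AngularPeriodic.pdt {R₁ R₂ : ℝ} {f : ℝ → ℝ → ℝ} (h : AngularPeriodic R₁ R₂ f) :
    AngularPeriodic R₁ R₂ (pdt f) := by
  intro r hr θ
  have : (fun y => f r (y + 2 * π)) = fun y => f r y := funext (h r hr)
  unfold _root_.pdt
  rw [← deriv_comp_add_const, this]

theorem AngularPeriodic.pdr {R₁ R₂ : ℝ} (h₁₂ : R₁ < R₂) {f : ℝ → ℝ → ℝ} (hf : Smooth f)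
    (h : AngularPeriodic R₁ R₂ f) : AngularPeriodic R₁ R₂ (pdr f) := by
  intro r hr θ
  have hc := hf.pdr.differentiable.continuous
  have hcont (y : ℝ) : Continuous fun x => _root_.pdr f x y :=
    hc.comp (continuous_id.prodMk continuous_const)
  have key : EqOn (fun x => _root_.pdr f x (θ + 2 * π)) (fun x => _root_.pdr f x θ)
      (Ioo R₁ R₂) := by
    intro x hx
    apply Filter.EventuallyEq.deriv_eq
    filter_upwards [Ioo_mem_nhds hx.1 hx.2] with y hy
    exact h y (Ioo_subset_Icc_self hy) θ
  have := key.closure (hcont _) (hcont _)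
  rw [closure_Ioo h₁₂.ne] at this
  exact this hr

/-- The iterated integral over the band `[R₁, R₂] × [0, 2π]`. -/
def bandInt (R₁ R₂ : ℝ) (G : ℝ → ℝ → ℝ) : ℝ :=
  ∫ r in R₁..R₂, ∫ θ in (0:ℝ)..(2 * π), G r θ

/-- Joint continuity over the closed radial band. -/
def BandCont (R₁ R₂ : ℝ) (G : ℝ → ℝ → ℝ) : Prop :=
  ContinuousOn (fun p : ℝ × ℝ => G p.1 p.2) (Icc R₁ R₂ ×ˢ univ)

section BandInt

variable {R₁ R₂ : ℝ} {F G : ℝ → ℝ → ℝ}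

theorem BandCont.integrableOn (hG : BandCont R₁ R₂ G) :
    IntegrableOn (fun p : ℝ × ℝ => G p.1 p.2) (Icc R₁ R₂ ×ˢ Icc 0 (2 * π)) :=
  (hG.mono (prod_mono_right (subset_univ _))).integrableOn_compact
    (isCompact_Icc.prod isCompact_Icc)

theorem bandInt_eq_setIntegral (h₁₂ : R₁ ≤ R₂) (hG : BandCont R₁ R₂ G) :
    bandInt R₁ R₂ G = ∫ p in Icc R₁ R₂ ×ˢ Icc 0 (2 * π), G p.1 p.2 := by
  rw [Measure.volume_eq_prod, setIntegral_prod _ hG.integrableOn]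
  simp only [bandInt, intervalIntegral.integral_of_le, h₁₂, two_pi_pos.le,
    setIntegral_congr_set (Ioc_ae_eq_Icc (α := ℝ) (μ := volume))]

theorem BandCont.add (hF : BandCont R₁ R₂ F) (hG : BandCont R₁ R₂ G) :
    BandCont R₁ R₂ (fun r θ => F r θ + G r θ) := ContinuousOn.add hF hG

theorem BandCont.const_mul (hG : BandCont R₁ R₂ G) (c : ℝ) :
    BandCont R₁ R₂ (fun r θ => c * G r θ) := continuousOn_const.mul hG

theorem bandInt_add (h₁₂ : R₁ ≤ R₂) (hF : BandCont R₁ R₂ F) (hG : BandCont R₁ R₂ G) :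
    bandInt R₁ R₂ (fun r θ => F r θ + G r θ) = bandInt R₁ R₂ F + bandInt R₁ R₂ G := by
  rw [bandInt_eq_setIntegral h₁₂ hF, bandInt_eq_setIntegral h₁₂ hG,
    bandInt_eq_setIntegral h₁₂ (hF.add hG)]
  exact integral_add hF.integrableOn hG.integrableOn

theorem bandInt_const_mul (c : ℝ) :
    bandInt R₁ R₂ (fun r θ => c * G r θ) = c * bandInt R₁ R₂ G := by
  simp [bandInt]

theorem bandInt_mono (h₁₂ : R₁ ≤ R₂) (hF : BandCont R₁ R₂ F) (hG : BandCont R₁ R₂ G)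
    (h : ∀ r ∈ Icc R₁ R₂, ∀ θ, F r θ ≤ G r θ) : bandInt R₁ R₂ F ≤ bandInt R₁ R₂ G := by
  rw [bandInt_eq_setIntegral h₁₂ hF, bandInt_eq_setIntegral h₁₂ hG]
  exact setIntegral_mono_on hF.integrableOn hG.integrableOn
    (measurableSet_Icc.prod measurableSet_Icc) fun p hp => h p.1 hp.1 p.2

theorem bandInt_congr (h₁₂ : R₁ ≤ R₂) (h : ∀ r ∈ Icc R₁ R₂, ∀ θ, F r θ = G r θ) :
    bandInt R₁ R₂ F = bandInt R₁ R₂ G := by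
  apply intervalIntegral.integral_congr
  intro r hr
  rw [uIcc_of_le h₁₂] at hr
  simp only [h r hr]

/-- The divergence theorem on the band, for fluxes that agree at `θ = 0` and `θ = 2π`. -/
theorem bandInt_divergence (h₁₂ : R₁ ≤ R₂) {P Q p q : ℝ → ℝ → ℝ}
    (hP : ∀ r ∈ Icc R₁ R₂, ∀ θ, DifferentiableAt ℝ (fun z : ℝ × ℝ => P z.1 z.2) (r, θ))
    (hQ : ∀ r ∈ Icc R₁ R₂, ∀ θ, DifferentiableAt ℝ (fun z : ℝ × ℝ => Q z.1 z.2) (r, θ))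
    (hp : ∀ r ∈ Icc R₁ R₂, ∀ θ, HasDerivAt (fun x => P x θ) (p r θ) r)
    (hq : ∀ r ∈ Icc R₁ R₂, ∀ θ, HasDerivAt (fun y => Q r y) (q r θ) θ)
    (hper : ∀ r ∈ Icc R₁ R₂, Q r (2 * π) = Q r 0)
    (hG : BandCont R₁ R₂ G) (hpq : ∀ r ∈ Icc R₁ R₂, ∀ θ, G r θ = p r θ + q r θ) :
    bandInt R₁ R₂ G =
      (∫ θ in (0:ℝ)..(2 * π), P R₂ θ) - ∫ θ in (0:ℝ)..(2 * π), P R₁ θ := by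
  set P' := fun z : ℝ × ℝ => fderiv ℝ (fun z : ℝ × ℝ => P z.1 z.2) z
  set Q' := fun z : ℝ × ℝ => fderiv ℝ (fun z : ℝ × ℝ => Q z.1 z.2) z
  have hP' : ∀ r ∈ Icc R₁ R₂, ∀ θ, P' (r, θ) (1, 0) = p r θ := fun r hr θ => by
    have h := (hP r hr θ).hasFDerivAt.comp_hasDerivAt r
      ((hasDerivAt_id r).prodMk (hasDerivAt_const r θ))
    exact HasDerivAt.unique h (hp r hr θ)
  have hQ' : ∀ r ∈ Icc R₁ R₂, ∀ θ, Q' (r, θ) (0, 1) = q r θ := fun r hr θ => by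
    have h := (hQ r hr θ).hasFDerivAt.comp_hasDerivAt θ
      ((hasDerivAt_const θ r).prodMk (hasDerivAt_id θ))
    exact HasDerivAt.unique h (hq r hr θ)
  have hI : EqOn (fun z : ℝ × ℝ => G z.1 z.2) (fun z => P' z (1, 0) + Q' z (0, 1))
      (Icc R₁ R₂ ×ˢ Icc 0 (2 * π)) := fun z hz => by
    simp only [hpq z.1 hz.1]
    rw [← hP' z.1 hz.1, ← hQ' z.1 hz.1]
  have key := integral2_divergence_prod_of_hasFDerivAt
    (fun z : ℝ × ℝ => P z.1 z.2) (fun z : ℝ × ℝ => Q z.1 z.2) P' Q' R₁ 0 R₂ (2 * π)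
    (by
      rw [uIcc_of_le h₁₂]
      exact fun z hz => (hP z.1 hz.1 z.2).continuousAt.continuousWithinAt)
    (by
      rw [uIcc_of_le h₁₂]
      exact fun z hz => (hQ z.1 hz.1 z.2).continuousAt.continuousWithinAt)
    (by
      rw [min_eq_left h₁₂, max_eq_right h₁₂]
      exact fun z hz => (hP z.1 (Ioo_subset_Icc_self hz.1) z.2).hasFDerivAt)
    (by
      rw [min_eq_left h₁₂, max_eq_right h₁₂]
      exact fun z hz => (hQ z.1 (Ioo_subset_Icc_self hz.1) z.2).hasFDerivAt)
    (by
      rw [uIcc_of_le h₁₂, uIcc_of_le two_pi_pos.le]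
      exact hG.integrableOn.congr_fun hI (measurableSet_Icc.prod measurableSet_Icc))
  have hflux : (∫ x in R₁..R₂, Q x (2 * π)) = ∫ x in R₁..R₂, Q x 0 := by
    apply intervalIntegral.integral_congr
    rw [uIcc_of_le h₁₂]
    exact hper
  rw [hflux, sub_self, zero_add] at key
  rw [← key]
  apply bandInt_congr h₁₂
  intro r hr θ
  rw [hP' r hr, hQ' r hr, hpq r hr]

end BandInt

theorem Smooth.continuousOn {f : ℝ → ℝ → ℝ} (hf : Smooth f) (s : Set (ℝ × ℝ)) :
    ContinuousOn (fun p : ℝ × ℝ => f p.1 p.2) s := hf.differentiable.continuous.continuousOn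

/-- The scalar boundary value class: smooth, periodic in the angle, vanishing on the outer
circle, and on the inner circle either vanishing or satisfying a Robin condition
`∂_r f = β f` with `β ≥ 0`. -/
structure RobinClass (R₁ R₂ : ℝ) (f : ℝ → ℝ → ℝ) : Prop where
  smooth : Smooth f
  periodic : AngularPeriodic R₁ R₂ f
  outer : ∀ θ, f R₂ θ = 0
  inner : (∀ θ, f R₁ θ = 0) ∨ ∃ β : ℝ, 0 ≤ β ∧ ∀ θ, pdr f R₁ θ = β * f R₁ θ

theorem pdt_eq_zero {f : ℝ → ℝ → ℝ} {r : ℝ} (h : ∀ θ, f r θ = 0) (θ : ℝ) : pdt f r θ = 0 := by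
  simp [pdt, h]

theorem AngularPeriodic.eq_zero {R₁ R₂ r : ℝ} {f : ℝ → ℝ → ℝ} (h : AngularPeriodic R₁ R₂ f)
    (hr : r ∈ Icc R₁ R₂) : f r (2 * π) = f r 0 := by
  simpa using h r hr 0

namespace RobinClass

variable {R₁ R₂ : ℝ} {f : ℝ → ℝ → ℝ}

theorem integral_pdr_mul_pdtt_nonpos (h₁₂ : R₁ < R₂) (hf : RobinClass R₁ R₂ f) :
    ∫ θ in (0:ℝ)..(2 * π), pdr f R₁ θ * pdt (pdt f) R₁ θ ≤ 0 := by
  rcases hf.inner with h | ⟨β, hβ, h⟩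
  · simp [pdt_eq_zero (pdt_eq_zero h)]
  have hR : R₁ ∈ Icc R₁ R₂ := left_mem_Icc.2 h₁₂.le
  have hcont {g : ℝ → ℝ → ℝ} (hg : Smooth g) : Continuous fun y => g R₁ y :=
    hg.differentiable.continuous.comp (continuous_const.prodMk continuous_id)
  have c0 := hcont hf.smooth
  have c1 := hcont hf.smooth.pdt
  have c2 := hcont hf.smooth.pdt.pdt
  have hparts : ∫ θ in (0:ℝ)..(2 * π),
      (pdt f R₁ θ * pdt f R₁ θ + f R₁ θ * pdt (pdt f) R₁ θ) = 0 := by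
    rw [intervalIntegral.integral_eq_sub_of_hasDerivAt
      (f := fun θ => f R₁ θ * pdt f R₁ θ)
      (fun θ _ => (hf.smooth.hasDerivAt_pdt R₁ θ).mul (hf.smooth.pdt.hasDerivAt_pdt R₁ θ))
      (Continuous.intervalIntegrable (by fun_prop) _ _)]
    rw [hf.periodic.eq_zero hR, hf.periodic.pdt.eq_zero hR, sub_self]
  rw [intervalIntegral.integral_add (Continuous.intervalIntegrable (by fun_prop) _ _)
    (Continuous.intervalIntegrable (by fun_prop) _ _)] at hparts
  have hpos : 0 ≤ ∫ θ in (0:ℝ)..(2 * π), pdt f R₁ θ * pdt f R₁ θ :=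
    intervalIntegral.integral_nonneg two_pi_pos.le fun θ _ => mul_self_nonneg _
  simp only [h, mul_assoc, intervalIntegral.integral_const_mul]
  exact mul_nonpos_of_nonneg_of_nonpos hβ (by linarith)

/-- The mixed term `∂_rr f ∂_θθ f` has nonnegative integral. -/
theorem bandInt_pdrr_mul_pdtt_nonneg (h₁₂ : R₁ < R₂) (hf : RobinClass R₁ R₂ f) :
    0 ≤ bandInt R₁ R₂ (fun r θ => pdr (pdr f) r θ * pdt (pdt f) r θ) := by
  have s := hf.smooth
  have hcomm : pdr (pdt f) = pdt (pdr f) := funext₂ s.pdr_pdt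
  have hcomm₂ (r θ : ℝ) : pdr (pdt (pdt f)) r θ = pdt (pdt (pdr f)) r θ := by
    rw [s.pdt.pdr_pdt, hcomm]
  have hpr := hf.periodic.pdr h₁₂ s
  have c1 := s.pdr.pdr.continuousOn (Icc R₁ R₂ ×ˢ univ)
  have c2 := s.pdt.pdt.continuousOn (Icc R₁ R₂ ×ˢ univ)
  have c3 := s.pdr.pdt.continuousOn (Icc R₁ R₂ ×ˢ univ)
  have d1 := s.pdr.differentiable
  have d2 := s.pdt.pdt.differentiable
  have d3 := s.pdr.pdt.differentiable
  have cG : BandCont R₁ R₂ (fun r θ => pdr (pdr f) r θ * pdt (pdt f) r θ) := by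
    unfold BandCont; fun_prop
  have cH : BandCont R₁ R₂ (fun r θ => pdr (pdr f) r θ * pdt (pdt f) r θ
      - pdt (pdr f) r θ ^ 2) := by
    unfold BandCont; fun_prop
  have hdiv := bandInt_divergence h₁₂.le
    (P := fun r θ => pdr f r θ * pdt (pdt f) r θ)
    (Q := fun r θ => -(pdr f r θ * pdt (pdr f) r θ))
    (fun r _ θ => (d1 _).mul (d2 _))
    (fun r _ θ => ((d1 _).mul (d3 _)).neg)
    (fun r _ θ => (s.pdr.hasDerivAt_pdr r θ).mul (s.pdt.pdt.hasDerivAt_pdr r θ))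
    (fun r _ θ => ((s.pdr.hasDerivAt_pdt r θ).mul (s.pdr.pdt.hasDerivAt_pdt r θ)).neg)
    (fun r hr => by simp only [hpr.eq_zero hr, hpr.pdt.eq_zero hr])
    cH (fun r _ θ => by rw [hcomm₂]; ring)
  have hle := bandInt_mono h₁₂.le cH cG fun r _ θ => by nlinarith [sq_nonneg (pdt (pdr f) r θ)]
  have hbd := hf.integral_pdr_mul_pdtt_nonpos h₁₂
  have hout : ∫ θ in (0:ℝ)..(2 * π), pdr f R₂ θ * pdt (pdt f) R₂ θ = 0 := by
    simp [pdt_eq_zero (pdt_eq_zero hf.outer)]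
  linarith

/-- The weighted energy inequality obtained by testing against `f`. -/
theorem bandInt_energy_nonpos (h₁₂ : R₁ < R₂) (hf : RobinClass R₁ R₂ f) {w w' c : ℝ → ℝ}
    (hw : ∀ r ∈ Icc R₁ R₂, HasDerivAt w (w' r) r) (hw' : ContinuousOn w' (Icc R₁ R₂))
    (hw₁ : 0 ≤ w R₁) (hc : ∀ r ∈ Icc R₁ R₂, DifferentiableAt ℝ c r) :
    bandInt R₁ R₂ (fun r θ => w' r * (f r θ * pdr f r θ)
      + w r * (pdr f r θ * pdr f r θ + f r θ * pdr (pdr f) r θ)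
      + c r * (pdt f r θ * pdt f r θ + f r θ * pdt (pdt f) r θ)) ≤ 0 := by
  have s := hf.smooth
  have hfst : MapsTo (Prod.fst : ℝ × ℝ → ℝ) (Icc R₁ R₂ ×ˢ univ) (Icc R₁ R₂) := fun z hz => hz.1
  have cw : ContinuousOn (fun z : ℝ × ℝ => w z.1) (Icc R₁ R₂ ×ˢ univ) :=
    ContinuousOn.comp (g := w) (fun r hr => (hw r hr).continuousAt.continuousWithinAt)
      continuousOn_fst hfst
  have cw' : ContinuousOn (fun z : ℝ × ℝ => w' z.1) (Icc R₁ R₂ ×ˢ univ) :=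
    hw'.comp continuousOn_fst hfst
  have cc : ContinuousOn (fun z : ℝ × ℝ => c z.1) (Icc R₁ R₂ ×ˢ univ) :=
    ContinuousOn.comp (g := c) (fun r hr => (hc r hr).continuousAt.continuousWithinAt)
      continuousOn_fst hfst
  have c0 := s.continuousOn (Icc R₁ R₂ ×ˢ univ)
  have c1 := s.pdr.continuousOn (Icc R₁ R₂ ×ˢ univ)
  have c2 := s.pdt.continuousOn (Icc R₁ R₂ ×ˢ univ)
  have c3 := s.pdr.pdr.continuousOn (Icc R₁ R₂ ×ˢ univ)
  have c4 := s.pdt.pdt.continuousOn (Icc R₁ R₂ ×ˢ univ)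
  have d0 := s.differentiable
  have d1 := s.pdr.differentiable
  have d2 := s.pdt.differentiable
  rw [bandInt_divergence h₁₂.le
    (P := fun r θ => w r * (f r θ * pdr f r θ)) (Q := fun r θ => c r * (f r θ * pdt f r θ))
    (fun r hr θ => DifferentiableAt.mul
      (DifferentiableAt.comp (g := w) (r, θ) (hw r hr).differentiableAt differentiableAt_fst)
      ((d0 _).mul (d1 _)))
    (fun r hr θ => DifferentiableAt.mul
      (DifferentiableAt.comp (g := c) (r, θ) (hc r hr) differentiableAt_fst)
      ((d0 _).mul (d2 _)))
    (fun r hr θ => (hw r hr).mul ((s.hasDerivAt_pdr r θ).mul (s.pdr.hasDerivAt_pdr r θ)))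
    (fun r _ θ => ((s.hasDerivAt_pdt r θ).mul (s.pdt.hasDerivAt_pdt r θ)).const_mul (c r))
    (fun r hr => by rw [hf.periodic.eq_zero hr, hf.periodic.pdt.eq_zero hr])
    (by
      exact ((cw'.mul (c0.mul c1)).add (cw.mul ((c1.mul c1).add (c0.mul c3)))).add
        (cc.mul ((c2.mul c2).add (c0.mul c4)))) (fun r _ θ => rfl)]
  have hin : 0 ≤ ∫ θ in (0:ℝ)..(2 * π), w R₁ * (f R₁ θ * pdr f R₁ θ) := by
    refine intervalIntegral.integral_nonneg two_pi_pos.le fun θ _ => mul_nonneg hw₁ ?_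
    rcases hf.inner with h | ⟨β, hβ, h⟩
    · simp [h]
    · rw [h, mul_left_comm]
      exact mul_nonneg hβ (mul_self_nonneg _)
  simpa [hf.outer] using hin

/-- The identity behind the radial Poincaré inequality. -/
theorem bandInt_poincare (h₁₂ : R₁ < R₂) (hf : RobinClass R₁ R₂ f) :
    bandInt R₁ R₂ (fun r θ => f r θ * f r θ
      + (r - R₁) * (pdr f r θ * f r θ + f r θ * pdr f r θ)) = 0 := by
  have s := hf.smooth
  have c0 := s.continuousOn (Icc R₁ R₂ ×ˢ univ)
  have c1 := s.pdr.continuousOn (Icc R₁ R₂ ×ˢ univ)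
  have d0 := s.differentiable
  rw [bandInt_divergence h₁₂.le
    (P := fun r θ => (r - R₁) * (f r θ * f r θ)) (Q := fun _ _ => 0)
    (fun r _ θ => (differentiableAt_fst.sub_const R₁).mul ((d0 _).mul (d0 _)))
    (fun r _ θ => differentiableAt_const _)
    (fun r _ θ => ((hasDerivAt_id r).sub_const R₁).mul
      ((s.hasDerivAt_pdr r θ).mul (s.hasDerivAt_pdr r θ)))
    (fun r _ θ => hasDerivAt_const _ _) (fun _ _ => rfl)
    (by unfold BandCont; fun_prop) (fun r _ θ => by simp)]
  simp [hf.outer]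

end RobinClass

/-- Comparison of integrals from a pointwise certificate whose correction terms have integrals
of known sign. -/
theorem bandInt_le_of_certificate {R₁ R₂ : ℝ} (h₁₂ : R₁ ≤ R₂) {T G X E Z : ℝ → ℝ → ℝ}
    {K a b c : ℝ} (cT : BandCont R₁ R₂ T) (cG : BandCont R₁ R₂ G) (cX : BandCont R₁ R₂ X)
    (cE : BandCont R₁ R₂ E) (cZ : BandCont R₁ R₂ Z) (ha : 0 ≤ a) (hb : 0 ≤ b)
    (hX : 0 ≤ bandInt R₁ R₂ X) (hE : bandInt R₁ R₂ E ≤ 0) (hZ : bandInt R₁ R₂ Z = 0)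
    (h : ∀ r ∈ Icc R₁ R₂, ∀ θ,
      T r θ ≤ K * G r θ + -a * X r θ + b * E r θ + c * Z r θ) :
    bandInt R₁ R₂ T ≤ K * bandInt R₁ R₂ G := by
  have h1 := (cG.const_mul K).add (cX.const_mul (-a))
  have h2 := h1.add (cE.const_mul b)
  have hm := bandInt_mono h₁₂ cT (h2.add (cZ.const_mul c)) h
  rw [bandInt_add h₁₂ h2 (cZ.const_mul c), bandInt_add h₁₂ h1 (cE.const_mul b),
    bandInt_add h₁₂ (cG.const_mul K) (cX.const_mul (-a))] at hm
  simp only [bandInt_const_mul] at hm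
  rw [hZ] at hm
  nlinarith [mul_nonneg ha hX, mul_nonneg hb (neg_nonneg.2 hE)]

/-- The sum of the squares of `f`, its first derivatives and its pure second derivatives. -/
def jetSq (f : ℝ → ℝ → ℝ) (r θ : ℝ) : ℝ :=
  f r θ ^ 2 + pdr f r θ ^ 2 + pdt f r θ ^ 2 + pdr (pdr f) r θ ^ 2 + pdt (pdt f) r θ ^ 2

theorem Smooth.bandCont_jetSq {f : ℝ → ℝ → ℝ} (s : Smooth f) (R₁ R₂ : ℝ) :
    BandCont R₁ R₂ (jetSq f) := by
  have c0 := s.continuousOn (Icc R₁ R₂ ×ˢ univ)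
  have c1 := s.pdr.continuousOn (Icc R₁ R₂ ×ˢ univ)
  have c2 := s.pdt.continuousOn (Icc R₁ R₂ ×ˢ univ)
  have c3 := s.pdr.pdr.continuousOn (Icc R₁ R₂ ×ˢ univ)
  have c4 := s.pdt.pdt.continuousOn (Icc R₁ R₂ ×ˢ univ)
  exact ((((c0.pow 2).add (c1.pow 2)).add (c2.pow 2)).add (c3.pow 2)).add (c4.pow 2)

theorem poincare_lower_bound {t ℓ : ℝ} (ht : 0 ≤ t) (hℓ : t ≤ ℓ) (f p : ℝ) :
    f ^ 2 / 2 - 2 * ℓ ^ 2 * p ^ 2 ≤ f * f + t * (p * f + f * p) := by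
  have h : t ^ 2 * p ^ 2 ≤ ℓ ^ 2 * p ^ 2 := by gcongr
  nlinarith [sq_nonneg (f + 2 * t * p)]

theorem RobinClass.bandInt_jetSq_le {R₁ R₂ : ℝ} {f : ℝ → ℝ → ℝ} (h₁₂ : R₁ < R₂)
    (hf : RobinClass R₁ R₂ f) :
    bandInt R₁ R₂ (jetSq f) ≤ (1 + (8 * (R₂ - R₁) ^ 2 + 1) ^ 2 / 4) *
      bandInt R₁ R₂ (fun r θ => (pdrr f r θ + pdtt f r θ) ^ 2) := by
  have s := hf.smooth
  have c0 := s.continuousOn (Icc R₁ R₂ ×ˢ univ)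
  have c1 := s.pdr.continuousOn (Icc R₁ R₂ ×ˢ univ)
  have c2 := s.pdt.continuousOn (Icc R₁ R₂ ×ˢ univ)
  have c3 := s.pdr.pdr.continuousOn (Icc R₁ R₂ ×ˢ univ)
  have c4 := s.pdt.pdt.continuousOn (Icc R₁ R₂ ×ˢ univ)
  have hE := hf.bandInt_energy_nonpos h₁₂ (w := fun _ => 1) (w' := fun _ => 0) (c := fun _ => 1)
    (fun r _ => hasDerivAt_const r _) continuousOn_const zero_le_one
    (fun r _ => differentiableAt_const _)
  refine bandInt_le_of_certificate h₁₂.le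
    (X := fun r θ => pdr (pdr f) r θ * pdt (pdt f) r θ) (s.bandCont_jetSq R₁ R₂) ((c3.add c4).pow 2)
    (c3.mul c4) ?_ ?_ zero_le_two (b := 8 * (R₂ - R₁) ^ 2 + 1) (by positivity)
    (hf.bandInt_pdrr_mul_pdtt_nonneg h₁₂) hE (hf.bandInt_poincare h₁₂) (c := 4) ?_
  · unfold BandCont; fun_prop
  · unfold BandCont; fun_prop
  · intro r hr θ
    have hp := poincare_lower_bound (sub_nonneg.2 hr.1) (sub_le_sub_right hr.2 R₁)
      (f r θ) (pdr f r θ)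
    simp only [jetSq, pdrr, pdtt]
    obtain ⟨ℓ, hℓ⟩ : ∃ ℓ, ℓ = (R₂ - R₁) ^ 2 := ⟨_, rfl⟩
    have hk : 0 ≤ ℓ := by rw [hℓ]; positivity
    rw [← hℓ] at hp ⊢
    linarith only [hp, mul_nonneg hk (sq_nonneg (pdt f r θ)),
      sq_nonneg (f r θ + (8 * ℓ + 1) / 2 * (pdr (pdr f) r θ + pdt (pdt f) r θ))]

theorem sq_polar_component_le {ρ k : ℝ} (hρ : 0 ≤ ρ) (hk : ρ ≤ k) (a b c d e : ℝ) :
    (a + ρ * b + ρ ^ 2 * c - ρ ^ 2 * d - 2 * ρ ^ 2 * e) ^ 2 ≤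
      5 * (1 + k ^ 2 + 4 * k ^ 4) * (a ^ 2 + b ^ 2 + c ^ 2 + d ^ 2 + e ^ 2) := by
  have h5 : (a + ρ * b + ρ ^ 2 * c - ρ ^ 2 * d - 2 * ρ ^ 2 * e) ^ 2 ≤
      5 * (a ^ 2 + ρ ^ 2 * b ^ 2 + ρ ^ 4 * c ^ 2 + ρ ^ 4 * d ^ 2 + 4 * ρ ^ 4 * e ^ 2) := by
    have key (x y z u v : ℝ) : (x + y + z - u - v) ^ 2 ≤
        5 * (x ^ 2 + y ^ 2 + z ^ 2 + u ^ 2 + v ^ 2) := by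
      nlinarith [sq_nonneg (x - y), sq_nonneg (x - z), sq_nonneg (x + u), sq_nonneg (x + v),
        sq_nonneg (y - z), sq_nonneg (y + u), sq_nonneg (y + v), sq_nonneg (z + u),
        sq_nonneg (z + v), sq_nonneg (u - v)]
    exact (key _ _ _ _ _).trans_eq (by ring)
  have h2 : ρ ^ 2 ≤ k ^ 2 := by gcongr
  have h4 : ρ ^ 4 ≤ k ^ 4 := by gcongr
  have n2 : 0 ≤ k ^ 2 := by positivity
  have n4 : 0 ≤ k ^ 4 := by positivity
  refine h5.trans
    ((mul_le_mul_of_nonneg_left ?_ (by norm_num : (0:ℝ) ≤ 5)).trans_eq (mul_assoc _ _ _).symm)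
  have bound {t : ℝ} (ht : t ≤ 1 + k ^ 2 + 4 * k ^ 4) (x : ℝ) :=
    mul_le_mul_of_nonneg_right ht (sq_nonneg x)
  linarith [bound (t := 1) (by linarith) a, bound (t := ρ ^ 2) (by linarith) b,
    bound (t := ρ ^ 4) (by linarith) c, bound (t := ρ ^ 4) (by linarith) d,
    bound (t := 4 * ρ ^ 4) (by linarith) e]

theorem second_derivatives_le {R₁ R₂ r : ℝ} (hR₁ : 0 < R₁) (h₁ : R₁ ≤ r) (h₂ : r ≤ R₂)
    (f g' p a b S : ℝ)
    (hS : S = a + 1 / r * p + 1 / r ^ 2 * b - f / r ^ 2 - 2 / r ^ 2 * g') :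
    a ^ 2 + b ^ 2 + 2 * (1 / R₁ ^ 2 + R₂ ^ 2) * (a * b) ≤
      (1 / R₁ ^ 2 + R₂ ^ 2) * (4 * (R₂ ^ 2 + 1 + 4 / R₁ ^ 2)) *
        (S ^ 2 + p ^ 2 + f ^ 2 + g' ^ 2) := by
  have hr : 0 < r := hR₁.trans_le h₁
  have hR₂ : 0 < R₂ := hr.trans_le h₂
  set ρ := 1 / r with hρ
  have hρr : ρ * r = 1 := by rw [hρ]; field_simp
  have hρ2 : ρ ^ 2 ≤ 1 / R₁ ^ 2 := by rw [hρ, one_div_pow]; gcongr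
  have hr2 : r ^ 2 ≤ R₂ ^ 2 := by gcongr
  have hexp : (r * S - p + ρ * f + 2 * ρ * g') ^ 2 =
      r ^ 2 * a ^ 2 + 2 * (a * b) + ρ ^ 2 * b ^ 2 := by
    rw [hS, hρ]; field_simp; ring
  have h4 : (r * S - p + ρ * f + 2 * ρ * g') ^ 2 ≤
      4 * (r ^ 2 * S ^ 2 + p ^ 2 + ρ ^ 2 * f ^ 2 + 4 * ρ ^ 2 * g' ^ 2) := by
    have key (x y z u : ℝ) : (x - y + z + u) ^ 2 ≤ 4 * (x ^ 2 + y ^ 2 + z ^ 2 + u ^ 2) := by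
      nlinarith [sq_nonneg (x + y), sq_nonneg (x - z), sq_nonneg (x - u), sq_nonneg (y + z),
        sq_nonneg (y + u), sq_nonneg (z - u)]
    exact (key _ _ _ _).trans_eq (by ring)
  have hq : 4 / R₁ ^ 2 = 4 * (1 / R₁ ^ 2) := by ring
  have n1 : 0 < 1 / R₁ ^ 2 := by positivity
  have n2 : 0 < R₂ ^ 2 := by positivity
  have hc : 4 * (r ^ 2 * S ^ 2 + p ^ 2 + ρ ^ 2 * f ^ 2 + 4 * ρ ^ 2 * g' ^ 2) ≤
      4 * (R₂ ^ 2 + 1 + 4 / R₁ ^ 2) * (S ^ 2 + p ^ 2 + f ^ 2 + g' ^ 2) := by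
    rw [hq]
    refine (mul_le_mul_of_nonneg_left ?_ (by norm_num : (0:ℝ) ≤ 4)).trans_eq
      (mul_assoc _ _ _).symm
    have bound {t : ℝ} (ht : t ≤ R₂ ^ 2 + 1 + 4 * (1 / R₁ ^ 2)) (x : ℝ) :=
      mul_le_mul_of_nonneg_right ht (sq_nonneg x)
    linarith [bound (t := r ^ 2) (by linarith) S, bound (t := 1) (by linarith) p,
      bound (t := ρ ^ 2) (by linarith) f, bound (t := 4 * ρ ^ 2) (by linarith) g']
  have ha : 1 ≤ (1 / R₁ ^ 2 + R₂ ^ 2) * r ^ 2 := by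
    have h : 1 ≤ 1 / R₁ ^ 2 * r ^ 2 := by
      rw [one_div_mul_eq_div, one_le_div (by positivity)]; gcongr
    nlinarith [mul_pos n2 (pow_pos hr 2)]
  have hb : 1 ≤ (1 / R₁ ^ 2 + R₂ ^ 2) * ρ ^ 2 := by
    have h : 1 ≤ R₂ ^ 2 * ρ ^ 2 := by
      calc (1:ℝ) = r ^ 2 * ρ ^ 2 := by rw [← mul_pow, mul_comm, hρr, one_pow]
        _ ≤ _ := by gcongr
    nlinarith [mul_nonneg n1.le (sq_nonneg ρ)]
  have hM := mul_le_mul_of_nonneg_left (h4.trans hc) (add_pos n1 n2).le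
  rw [hexp] at hM
  have h1 := mul_le_mul_of_nonneg_right ha (sq_nonneg a)
  have h2 := mul_le_mul_of_nonneg_right hb (sq_nonneg b)
  linarith

/-- A Young inequality tailored to the weighted energy identity. -/
theorem weighted_young {N k r R : ℝ} (hN : 0 < N) (hr : 0 ≤ r) (hR : r ≤ R) (f S : ℝ) :
    -(N * f ^ 2) - k ^ 2 * R ^ 2 / (4 * N) * S ^ 2 ≤ k * (r * (f * S)) := by
  have h1 : k ^ 2 * r ^ 2 / (4 * N) * S ^ 2 ≤ k ^ 2 * R ^ 2 / (4 * N) * S ^ 2 := by gcongr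
  have h2 : N * f ^ 2 + k * (r * (f * S)) + k ^ 2 * r ^ 2 / (4 * N) * S ^ 2 =
      N * (f + k * r * S / (2 * N)) ^ 2 := by
    field_simp; ring
  have h3 : 0 ≤ N * (f + k * r * S / (2 * N)) ^ 2 := by positivity
  linarith

/-- The pointwise certificate for the lower bound on the polar vector Laplacian. -/
theorem jet_le_polar_certificate {R₁ R₂ r : ℝ} (hR₁ : 0 < R₁) (h₁ : R₁ ≤ r) (h₂ : r ≤ R₂)
    {M N k : ℝ} (hM : M = 1 / R₁ ^ 2 + R₂ ^ 2)
    (hN : N = 1 + M * (4 * (R₂ ^ 2 + 1 + 4 / R₁ ^ 2)))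
    (hk : k = (N + 16 * N * (R₂ - R₁) ^ 2) / R₁ + 2 * N * R₂)
    {f fr ft frr ftt g gr gt grr gtt S₁ S₂ : ℝ}
    (hS₁ : S₁ = frr + 1 / r * fr + 1 / r ^ 2 * ftt - f / r ^ 2 - 2 / r ^ 2 * gt)
    (hS₂ : S₂ = grr + 1 / r * gr + 1 / r ^ 2 * gtt - g / r ^ 2 + 2 / r ^ 2 * ft) :
    (f ^ 2 + fr ^ 2 + ft ^ 2 + frr ^ 2 + ftt ^ 2) + (g ^ 2 + gr ^ 2 + gt ^ 2 + grr ^ 2 + gtt ^ 2) ≤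
      (N + k ^ 2 * R₂ ^ 2 / (4 * N)) * (S₁ ^ 2 + S₂ ^ 2) + -(2 * M) * (frr * ftt + grr * gtt)
      + k * ((1 * (f * fr) + r * (fr * fr + f * frr) + 1 / r * (ft * ft + f * ftt))
        + (1 * (g * gr) + r * (gr * gr + g * grr) + 1 / r * (gt * gt + g * gtt)))
      + 8 * N * ((f * f + (r - R₁) * (fr * f + f * fr))
        + (g * g + (r - R₁) * (gr * g + g * gr))) := by
  have hr : 0 < r := hR₁.trans_le h₁
  have hR₂ : 0 < R₂ := hr.trans_le h₂
  have hM0 : 0 < M := by rw [hM]; positivity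
  have hN0 : 0 < N := by rw [hN]; positivity
  have hk0 : 0 < k := by rw [hk]; positivity
  have hf := second_derivatives_le hR₁ h₁ h₂ f gt fr frr ftt S₁ hS₁
  have hg := second_derivatives_le hR₁ h₁ h₂ g (-ft) gr grr gtt S₂ (by rw [hS₂]; ring)
  rw [← hM, show M * (4 * (R₂ ^ 2 + 1 + 4 / R₁ ^ 2)) = N - 1 by rw [hN]; ring] at hf hg
  have hE : (1 * (f * fr) + r * (fr * fr + f * frr) + 1 / r * (ft * ft + f * ftt))
        + (1 * (g * gr) + r * (gr * gr + g * grr) + 1 / r * (gt * gt + g * gtt)) =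
      r * (f * S₁) + r * (g * S₂) + r * (fr ^ 2 + gr ^ 2)
        + 1 / r * ((ft - g) ^ 2 + (gt + f) ^ 2) := by
    rw [hS₁, hS₂]; field_simp; ring
  have y₁ := weighted_young (k := k) hN0 hr.le h₂ f S₁
  have y₂ := weighted_young (k := k) hN0 hr.le h₂ g S₂
  have p₁ := poincare_lower_bound (sub_nonneg.2 h₁) (sub_le_sub_right h₂ R₁) f fr
  have p₂ := poincare_lower_bound (sub_nonneg.2 h₁) (sub_le_sub_right h₂ R₁) g gr
  have hkr : N + 16 * N * (R₂ - R₁) ^ 2 ≤ k * r := by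
    calc N + 16 * N * (R₂ - R₁) ^ 2 = (N + 16 * N * (R₂ - R₁) ^ 2) / R₁ * R₁ := by field_simp
      _ ≤ k * r := by
        gcongr
        rw [hk]
        exact le_add_of_nonneg_right (by positivity)
  have hkρ : 2 * N ≤ k * (1 / r) := by
    rw [mul_one_div, le_div_iff₀ hr]
    calc 2 * N * r ≤ 2 * N * R₂ := by gcongr
      _ ≤ k := by
        rw [hk]
        exact le_add_of_nonneg_left (by positivity)
  have e₁ := mul_le_mul_of_nonneg_right hkr (by positivity : 0 ≤ fr ^ 2 + gr ^ 2)
  have e₂ := mul_le_mul_of_nonneg_right hkρ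
    (by positivity : 0 ≤ (ft - g) ^ 2 + (gt + f) ^ 2)
  have t : N * (ft ^ 2 + gt ^ 2) ≤
      N * (2 * ((ft - g) ^ 2 + (gt + f) ^ 2) + 2 * (f ^ 2 + g ^ 2)) := by
    refine mul_le_mul_of_nonneg_left ?_ hN0.le
    linear_combination sq_nonneg (ft - 2 * g) + sq_nonneg (gt + 2 * f)
  have p := mul_le_mul_of_nonneg_left (add_le_add p₁ p₂) (by positivity : 0 ≤ 8 * N)
  rw [hE]
  linear_combination hf + hg + y₁ + y₂ + e₁ + e₂ + t + p + sq_nonneg S₁ + sq_nonneg S₂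

section Comparison

variable {R₁ R₂ : ℝ} {f g : ℝ → ℝ → ℝ}

theorem bandCont_polar_component (hR₁ : 0 < R₁) (hf : Smooth f) (hg : Smooth g) (c : ℝ) :
    BandCont R₁ R₂ (fun r θ => deltaR f r θ - f r θ / r ^ 2 + c / r ^ 2 * pdt g r θ) := by
  have c0 := hf.continuousOn (Icc R₁ R₂ ×ˢ univ)
  have c1 := hf.pdr.continuousOn (Icc R₁ R₂ ×ˢ univ)
  have c2 := hg.pdt.continuousOn (Icc R₁ R₂ ×ˢ univ)
  have c3 := hf.pdr.pdr.continuousOn (Icc R₁ R₂ ×ˢ univ)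
  have c4 := hf.pdt.pdt.continuousOn (Icc R₁ R₂ ×ˢ univ)
  have hfst : ContinuousOn (fun z : ℝ × ℝ => z.1) (Icc R₁ R₂ ×ˢ univ) := continuousOn_fst
  have h1 : ∀ z ∈ (Icc R₁ R₂ ×ˢ univ : Set (ℝ × ℝ)), z.1 ≠ 0 := fun z hz =>
    (hR₁.trans_le hz.1.1).ne'
  have h2 : ∀ z ∈ (Icc R₁ R₂ ×ˢ univ : Set (ℝ × ℝ)), z.1 ^ 2 ≠ 0 := fun z hz =>
    pow_ne_zero 2 (h1 z hz)
  have hinv (a : ℝ) := (continuousOn_const (c := a)).div (hfst.pow 2) h2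
  exact (((c3.add ((continuousOn_const.div hfst h1).mul c1)).add ((hinv 1).mul c4)).sub
    (c0.div (hfst.pow 2) h2)).add ((hinv c).mul c2)

theorem bandCont_polar (hR₁ : 0 < R₁) (hf : Smooth f) (hg : Smooth g) :
    BandCont R₁ R₂ (fun r θ => (deltaR f r θ - f r θ / r ^ 2 - (2 / r ^ 2) * pdt g r θ) ^ 2 +
      (deltaR g r θ - g r θ / r ^ 2 + (2 / r ^ 2) * pdt f r θ) ^ 2) := by
  have h₁ := bandCont_polar_component (R₂ := R₂) hR₁ hf hg (-2)
  simp only [neg_div, neg_mul, ← sub_eq_add_neg] at h₁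
  exact (ContinuousOn.pow h₁ 2).add
    (ContinuousOn.pow (bandCont_polar_component (R₂ := R₂) hR₁ hg hf 2) 2)

theorem bandCont_laplacian (hf : Smooth f) :
    BandCont R₁ R₂ (fun r θ => (pdrr f r θ + pdtt f r θ) ^ 2) :=
  ((hf.pdr.pdr.continuousOn _).add (hf.pdt.pdt.continuousOn _)).pow 2

theorem lapSq_eq (h₁₂ : R₁ ≤ R₂) (hf : Smooth f) (hg : Smooth g) :
    lapSq R₁ R₂ f g = bandInt R₁ R₂ (fun r θ => (pdrr f r θ + pdtt f r θ) ^ 2) +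
      bandInt R₁ R₂ (fun r θ => (pdrr g r θ + pdtt g r θ) ^ 2) :=
  bandInt_add h₁₂ (bandCont_laplacian hf) (bandCont_laplacian hg)

theorem lapSq_le_jetSq (h₁₂ : R₁ ≤ R₂) (hf : Smooth f) (hg : Smooth g) :
    lapSq R₁ R₂ f g ≤ 2 * bandInt R₁ R₂ (fun r θ => jetSq f r θ + jetSq g r θ) := by
  have cT := (hf.bandCont_jetSq R₁ R₂).add (hg.bandCont_jetSq R₁ R₂)
  rw [← bandInt_const_mul]
  refine bandInt_mono h₁₂ ((bandCont_laplacian hf).add (bandCont_laplacian hg))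
    (cT.const_mul 2) fun r _ θ => ?_
  simp only [jetSq, pdrr, pdtt]
  nlinarith [sq_nonneg (f r θ), sq_nonneg (pdr f r θ), sq_nonneg (pdt f r θ),
    sq_nonneg (g r θ), sq_nonneg (pdr g r θ), sq_nonneg (pdt g r θ),
    sq_nonneg (pdr (pdr f) r θ - pdt (pdt f) r θ), sq_nonneg (pdr (pdr g) r θ - pdt (pdt g) r θ)]

theorem SSq_le_jetSq (hR₁ : 0 < R₁) (h₁₂ : R₁ ≤ R₂) (hf : Smooth f) (hg : Smooth g) :
    SSq R₁ R₂ f g ≤ 10 * (1 + (1 / R₁) ^ 2 + 4 * (1 / R₁) ^ 4) *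
      bandInt R₁ R₂ (fun r θ => jetSq f r θ + jetSq g r θ) := by
  have cT := (hf.bandCont_jetSq R₁ R₂).add (hg.bandCont_jetSq R₁ R₂)
  rw [← bandInt_const_mul]
  refine bandInt_mono h₁₂ (bandCont_polar hR₁ hf hg) (cT.const_mul _) fun r hr θ => ?_
  have hr0 : 0 < r := hR₁.trans_le hr.1
  have hρ : 1 / r ≤ 1 / R₁ := by gcongr; exact hr.1
  have e₁ := sq_polar_component_le (by positivity) hρ (pdr (pdr f) r θ) (pdr f r θ)
    (pdt (pdt f) r θ) (f r θ) (pdt g r θ)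
  have e₂ := sq_polar_component_le (by positivity) hρ (pdr (pdr g) r θ) (pdr g r θ)
    (pdt (pdt g) r θ) (g r θ) (-pdt f r θ)
  have hκ : 0 ≤ 1 + (1 / R₁) ^ 2 + 4 * (1 / R₁) ^ 4 := by positivity
  generalize 1 + (1 / R₁) ^ 2 + 4 * (1 / R₁) ^ 4 = κ at *
  have e₃ : 5 * κ * ((pdr (pdr f) r θ ^ 2 + pdr f r θ ^ 2 + pdt (pdt f) r θ ^ 2 + f r θ ^ 2
      + pdt g r θ ^ 2) + (pdr (pdr g) r θ ^ 2 + pdr g r θ ^ 2 + pdt (pdt g) r θ ^ 2 + g r θ ^ 2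
      + (-pdt f r θ) ^ 2)) ≤ 10 * κ * (jetSq f r θ + jetSq g r θ) := by
    have h0 : 0 ≤ jetSq f r θ + jetSq g r θ := by unfold jetSq; positivity
    have := mul_nonneg hκ h0
    simp only [jetSq] at this ⊢
    linarith
  refine le_trans (le_of_eq ?_) ((add_le_add e₁ e₂).trans (le_trans (le_of_eq ?_) e₃))
  · simp only [deltaR, pdrr, pdtt]
    ring
  · ring

theorem RobinClass.jetSq_le_lapSq (h₁₂ : R₁ < R₂) (hf : RobinClass R₁ R₂ f)
    (hg : RobinClass R₁ R₂ g) :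
    bandInt R₁ R₂ (fun r θ => jetSq f r θ + jetSq g r θ) ≤
      (1 + (8 * (R₂ - R₁) ^ 2 + 1) ^ 2 / 4) * lapSq R₁ R₂ f g := by
  rw [bandInt_add h₁₂.le (hf.smooth.bandCont_jetSq R₁ R₂) (hg.smooth.bandCont_jetSq R₁ R₂),
    lapSq_eq h₁₂.le hf.smooth hg.smooth, mul_add]
  exact add_le_add (hf.bandInt_jetSq_le h₁₂) (hg.bandInt_jetSq_le h₁₂)

theorem exists_jetSq_le_SSq (hR₁ : 0 < R₁) (h₁₂ : R₁ < R₂) :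
    ∃ K : ℝ, 0 < K ∧ ∀ f g : ℝ → ℝ → ℝ, RobinClass R₁ R₂ f → RobinClass R₁ R₂ g →
      bandInt R₁ R₂ (fun r θ => jetSq f r θ + jetSq g r θ) ≤ K * SSq R₁ R₂ f g := by
  have hR₂ : 0 < R₂ := hR₁.trans h₁₂
  obtain ⟨M, hM⟩ : ∃ M, M = 1 / R₁ ^ 2 + R₂ ^ 2 := ⟨_, rfl⟩
  obtain ⟨N, hN⟩ : ∃ N, N = 1 + M * (4 * (R₂ ^ 2 + 1 + 4 / R₁ ^ 2)) := ⟨_, rfl⟩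
  obtain ⟨k, hk⟩ : ∃ k, k = (N + 16 * N * (R₂ - R₁) ^ 2) / R₁ + 2 * N * R₂ := ⟨_, rfl⟩
  have hM0 : 0 < M := by rw [hM]; positivity
  have hN0 : 0 < N := by rw [hN]; positivity
  have hk0 : 0 < k := by rw [hk]; positivity
  refine ⟨N + k ^ 2 * R₂ ^ 2 / (4 * N), by positivity, fun f g hf hg => ?_⟩
  have cont {h : ℝ → ℝ → ℝ} (s : Smooth h) :
      BandCont R₁ R₂ (fun r θ => pdr (pdr h) r θ * pdt (pdt h) r θ) ∧
      BandCont R₁ R₂ (fun r θ => 1 * (h r θ * pdr h r θ)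
        + r * (pdr h r θ * pdr h r θ + h r θ * pdr (pdr h) r θ)
        + 1 / r * (pdt h r θ * pdt h r θ + h r θ * pdt (pdt h) r θ)) ∧
      BandCont R₁ R₂ (fun r θ => h r θ * h r θ
        + (r - R₁) * (pdr h r θ * h r θ + h r θ * pdr h r θ)) := by
    have c0 := s.continuousOn (Icc R₁ R₂ ×ˢ univ)
    have c1 := s.pdr.continuousOn (Icc R₁ R₂ ×ˢ univ)
    have c2 := s.pdt.continuousOn (Icc R₁ R₂ ×ˢ univ)
    have c3 := s.pdr.pdr.continuousOn (Icc R₁ R₂ ×ˢ univ)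
    have c4 := s.pdt.pdt.continuousOn (Icc R₁ R₂ ×ˢ univ)
    have hfst : ContinuousOn (fun z : ℝ × ℝ => z.1) (Icc R₁ R₂ ×ˢ univ) := continuousOn_fst
    refine ⟨c3.mul c4, ?_, ?_⟩
    · exact ((continuousOn_const.mul (c0.mul c1)).add
        (hfst.mul ((c1.mul c1).add (c0.mul c3)))).add
        ((continuousOn_const.div hfst fun z hz => (hR₁.trans_le hz.1.1).ne').mul
          ((c2.mul c2).add (c0.mul c4)))
    · unfold BandCont; fun_prop
  have energy {h : ℝ → ℝ → ℝ} (hh : RobinClass R₁ R₂ h) :=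
    hh.bandInt_energy_nonpos h₁₂ (w := fun r => r) (w' := fun _ => 1) (c := fun r => 1 / r)
      (fun r _ => hasDerivAt_id r) continuousOn_const hR₁.le
      (fun r hr => (differentiableAt_const _).div differentiableAt_id (hR₁.trans_le hr.1).ne')
  obtain ⟨fX, fE, fZ⟩ := cont hf.smooth
  obtain ⟨gX, gE, gZ⟩ := cont hg.smooth
  refine bandInt_le_of_certificate h₁₂.le
    ((hf.smooth.bandCont_jetSq R₁ R₂).add (hg.smooth.bandCont_jetSq R₁ R₂))
    (bandCont_polar hR₁ hf.smooth hg.smooth) (fX.add gX) (fE.add gE) (fZ.add gZ)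
    (a := 2 * M) (b := k) (c := 8 * N) (by positivity) hk0.le ?_ ?_ ?_ ?_
  · rw [bandInt_add h₁₂.le fX gX]
    exact add_nonneg (hf.bandInt_pdrr_mul_pdtt_nonneg h₁₂) (hg.bandInt_pdrr_mul_pdtt_nonneg h₁₂)
  · rw [bandInt_add h₁₂.le fE gE]
    exact add_nonpos (energy hf) (energy hg)
  · rw [bandInt_add h₁₂.le fZ gZ, hf.bandInt_poincare h₁₂, hg.bandInt_poincare h₁₂, add_zero]
  · intro r hr θ
    exact jet_le_polar_certificate hR₁ hr.1 hr.2 hM hN hk rfl rfl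

end Comparison

theorem NavierAdmissible.robinClass {R₁ R₂ μ α : ℝ} {vr vθ : ℝ → ℝ → ℝ} (hR₁ : 0 < R₁)
    (hα : 0 ≤ 1 - α * R₁ / μ) (h : NavierAdmissible R₁ R₂ μ α vr vθ) :
    RobinClass R₁ R₂ vr ∧ RobinClass R₁ R₂ vθ := by
  obtain ⟨⟨sr, sθ, pr, pθ, -, r₁, r₂, θ₂⟩, hN⟩ := h
  refine ⟨⟨sr, pr, r₂, Or.inl r₁⟩, ⟨sθ, pθ, θ₂, Or.inr ⟨_, ?_, hN⟩⟩⟩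
  have : 1 / R₁ - α / μ = (1 - α * R₁ / μ) / R₁ := by field_simp
  rw [this]
  positivity

theorem statement6 (R₁ R₂ : ℝ) (hR₁ : 0 < R₁) (hR₁₂ : R₁ < R₂) :
    ∃ C₁ C₂ : ℝ, 0 < C₁ ∧ 0 < C₂ ∧
      ∀ μ α : ℝ, 0 < μ → 0 ≤ 1 - α * R₁ / μ →
        ∀ vr vθ : ℝ → ℝ → ℝ, NavierAdmissible R₁ R₂ μ α vr vθ →
          C₁ * lapSq R₁ R₂ vr vθ ≤ SSq R₁ R₂ vr vθ ∧
          SSq R₁ R₂ vr vθ ≤ C₂ * lapSq R₁ R₂ vr vθ := by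
  obtain ⟨K, hK, hlow⟩ := exists_jetSq_le_SSq hR₁ hR₁₂
  refine ⟨1 / (2 * K), 10 * (1 + (1 / R₁) ^ 2 + 4 * (1 / R₁) ^ 4) *
    (1 + (8 * (R₂ - R₁) ^ 2 + 1) ^ 2 / 4), by positivity, by positivity, ?_⟩
  intro μ α _ hα vr vθ h
  obtain ⟨hr, hθ⟩ := h.robinClass hR₁ hα
  constructor
  · rw [one_div_mul_eq_div, div_le_iff₀ (by positivity)]
    linarith [lapSq_le_jetSq hR₁₂.le hr.smooth hθ.smooth, hlow vr vθ hr hθ]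
  · refine (SSq_le_jetSq hR₁ hR₁₂.le hr.smooth hθ.smooth).trans ?_
    rw [mul_assoc _ _ (lapSq R₁ R₂ vr vθ)]
    exact mul_le_mul_of_nonneg_left (hr.jetSq_le_lapSq hR₁₂ hθ) (by positivity)

end
end
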